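/- arXiv:math/9810012 — 2 statements merged into one kernel-verified Lean document; each statement's English description precedes it below -/
import Mathlib

section
/- For every n ≥ 1, the fundamental group of rat(n,2), at any basepoint, is isomorphic to the group of integers ℤ. -/
open OnePoint Projectivization

noncomputable section

/-- Real projective `m`-space, the projectivization of `ℝ^{m+1}`. -/
abbrev RP (m : ℕ) := Projectivization ℝ (Fin (m + 1) → ℝ)

instance (m : ℕ) : TopologicalSpace (RP m) :=
  inferInstanceAs (TopologicalSpace (Quotient _))

/-- The basepoint `[1 : 1 : ⋯ : 1]` of `ℝP^m`. -/
def basept (m : ℕ) : RP m :=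
  Projectivization.mk ℝ (fun _ => (1 : ℝ)) (by
    intro h
    exact one_ne_zero (congrFun h 0))

/-- The based loop space `Ω ℝP^m`: continuous maps `ℝP¹ = ℝ ∪ {∞} → ℝP^m`
sending `∞` to the basepoint, with the compact-open topology. -/
abbrev OmegaRP (m : ℕ) := {f : C(OnePoint ℝ, RP m) // f ∞ = basept m}

/-- The set of based loops arising from `(m+1)`-tuples of monic real polynomials of
degree `n` with no common complex root. -/
def RRat (n m : ℕ) : Set (OmegaRP m) :=
  {f | ∃ p : Fin (m + 1) → Polynomial ℝ,
    (∀ i, (p i).Monic) ∧ (∀ i, (p i).natDegree = n) ∧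
    (∀ z : ℂ, ∃ i, Polynomial.aeval z (p i) ≠ 0) ∧
    ∀ x : ℝ, ∃ hx : (fun i => (p i).eval x) ≠ 0,
      f.1 (x : OnePoint ℝ) = Projectivization.mk ℝ (fun i => (p i).eval x) hx}

/-- `rat n m` is the closure of `RRat n m` in `Ω ℝP^m`. -/
def ratSet (n m : ℕ) : Set (OmegaRP m) := closure (RRat n m)

section

/-- The straight segment between two points of a real topological vector space. -/
def segPath {V : Type*} [AddCommGroup V] [Module ℝ V] [TopologicalSpace V] [ContinuousAdd V]
    [ContinuousSMul ℝ V] (a b : V) : Path a b where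
  toFun t := (1 - (t : ℝ)) • a + (t : ℝ) • b
  continuous_toFun := by fun_prop
  source' := by simp
  target' := by simp

section SliceClass

variable {V X : Type*} [AddCommGroup V] [Module ℝ V] [TopologicalSpace V] [ContinuousAdd V]
  [ContinuousSMul ℝ V] [TopologicalSpace X]

/-- Closing up a path whose endpoints lie on a slice `ι : V → X` to a loop at `ι v`, by
segments inside the slice. -/
def sliceLoop (ι : C(V, X)) (v : V) {a b : V} (γ : Path (ι a) (ι b)) : Path (ι v) (ι v) :=
  (((segPath v a).map ι.continuous).trans γ).trans ((segPath v b).map ι.continuous).symm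

/-- The homotopy class of `sliceLoop`. -/
def sliceClass (ι : C(V, X)) (v : V) {a b : V} (γ : Path (ι a) (ι b)) :
    Path.Homotopic.Quotient (ι v) (ι v) :=
  .mk (sliceLoop ι v γ)

variable (ι : C(V, X)) (v : V)

theorem sliceClass_congr {a b : V} {γ γ' : Path (ι a) (ι b)} (h : γ.Homotopic γ') :
    sliceClass ι v γ = sliceClass ι v γ' := by
  have h' := Path.Homotopic.Quotient.eq.2 h
  simp only [sliceClass, sliceLoop, Path.Homotopic.Quotient.mk_trans, h']

theorem sliceClass_refl (a : V) : sliceClass ι v (Path.refl (ι a)) = .refl _ := by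
  simp only [sliceClass, sliceLoop, Path.Homotopic.Quotient.mk_trans,
    Path.Homotopic.Quotient.mk_refl, Path.Homotopic.Quotient.trans_refl,
    Path.Homotopic.Quotient.mk_symm, Path.Homotopic.Quotient.trans_symm]

theorem sliceClass_trans {a b c : V} (γ : Path (ι a) (ι b)) (γ' : Path (ι b) (ι c)) :
    sliceClass ι v (γ.trans γ') = (sliceClass ι v γ).trans (sliceClass ι v γ') := by
  simp only [sliceClass, sliceLoop, Path.Homotopic.Quotient.mk_trans,
    Path.Homotopic.Quotient.trans_assoc, Path.Homotopic.Quotient.mk_symm]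
  congr 2
  rw [← Path.Homotopic.Quotient.trans_assoc (.symm _), Path.Homotopic.Quotient.symm_trans,
    Path.Homotopic.Quotient.refl_trans]

theorem sliceClass_base (γ : Path (ι v) (ι v)) : sliceClass ι v γ = .mk γ := by
  have h : (segPath v v).map ι.continuous = Path.refl (ι v) := by
    ext t
    simp [segPath, ← add_smul]
  simp [sliceClass, sliceLoop, h, Path.Homotopic.Quotient.mk_trans]

theorem continuous_segPath_family {Y : Type*} [TopologicalSpace Y] {a : Y → V}
    (ha : Continuous a) :
    Continuous (fun z : Y × unitInterval => ((segPath v (a z.1)).map ι.continuous) z.2) := by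
  simp only [segPath, Path.map_coe, Function.comp_apply, Path.coe_mk_mk]
  fun_prop

theorem sliceClass_family {a b : unitInterval → V} (ha : Continuous a) (hb : Continuous b)
    (γ : ∀ t, Path (ι (a t)) (ι (b t))) (hγ : Continuous ↿γ) :
    sliceClass ι v (γ 0) = sliceClass ι v (γ 1) := by
  refine Path.Homotopic.Quotient.eq.2 ⟨⟨⟨⟨fun z => sliceLoop ι v (γ z.1) z.2, ?_⟩, ?_, ?_⟩, ?_⟩⟩
  · have h := Path.trans_continuous_family
      (fun t => ((segPath v (a t)).map ι.continuous).trans (γ t))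
      (Path.trans_continuous_family (fun t => (segPath v (a t)).map ι.continuous)
        (continuous_segPath_family ι v ha) γ hγ)
      (fun t => ((segPath v (b t)).map ι.continuous).symm)
      (Path.symm_continuous_family _ (continuous_segPath_family ι v hb))
    exact h
  · intro t; simp
  · intro t; simp
  · intro t x hx
    rcases hx with rfl | rfl <;> simp

end SliceClass

end

section

/-- Evaluation of the monic real polynomial with lower coefficients `p`. -/
def evP {n : ℕ} (x : ℝ) (p : Fin n → ℝ) : ℝ := x ^ n + ∑ i, p i * x ^ (i : ℕ)

/-- Evaluation at a real point of the complex polynomial of degree `< n` with coefficients `q`. -/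
def evQ {n : ℕ} (x : ℝ) : (Fin n → ℂ) →ₗ[ℂ] ℂ := ∑ i : Fin n, (x : ℂ) ^ (i : ℕ) • LinearMap.proj i

theorem evQ_apply {n : ℕ} (x : ℝ) (q : Fin n → ℂ) :
    evQ x q = ∑ i : Fin n, (x : ℂ) ^ (i : ℕ) * q i := by
  simp [evQ]

@[fun_prop]
theorem Continuous.evP {Y : Type*} [TopologicalSpace Y] {n : ℕ} {x : Y → ℝ} {p : Y → Fin n → ℝ}
    (hx : Continuous x) (hp : Continuous p) : Continuous fun y => evP (x y) (p y) := by
  unfold _root_.evP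
  fun_prop

@[fun_prop]
theorem Continuous.evQ {Y : Type*} [TopologicalSpace Y] {n : ℕ} {x : Y → ℝ} {q : Y → Fin n → ℂ}
    (hx : Continuous x) (hq : Continuous q) : Continuous fun y => evQ (x y) (q y) := by
  simp only [evQ_apply]
  fun_prop

/-- Pairs of a monic real polynomial of degree `n` and a complex polynomial of degree `< n`
without common real root. -/
def coprimeLocus (n : ℕ) : Set ((Fin n → ℝ) × (Fin n → ℂ)) :=
  {e | ∀ x : ℝ, evP x e.1 = 0 → evQ x e.2 ≠ 0}

/-- The polynomial `X ^ n + ∑ p i X ^ i`. -/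
def polyP {n : ℕ} (p : Fin n → ℝ) : Polynomial ℝ :=
  Polynomial.X ^ n + ∑ i, Polynomial.C (p i) * Polynomial.X ^ (i : ℕ)

theorem degree_lower_lt {n : ℕ} (p : Fin n → ℝ) :
    (∑ i, Polynomial.C (p i) * Polynomial.X ^ (i : ℕ)).degree < (n : WithBot ℕ) := by
  refine (Polynomial.degree_sum_le _ _).trans_lt ?_
  refine (Finset.sup_lt_iff (WithBot.bot_lt_coe n)).2 fun i _ => ?_
  exact (Polynomial.degree_C_mul_X_pow_le _ _).trans_lt (Nat.cast_lt.2 i.2)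

theorem polyP_monic {n : ℕ} (p : Fin n → ℝ) : (polyP p).Monic :=
  Polynomial.monic_X_pow_add (degree_lower_lt p)

theorem natDegree_polyP {n : ℕ} (p : Fin n → ℝ) : (polyP p).natDegree = n := by
  rw [polyP, Polynomial.natDegree_add_eq_left_of_degree_lt, Polynomial.natDegree_X_pow]
  simpa using degree_lower_lt p

theorem eval_polyP {n : ℕ} (p : Fin n → ℝ) (x : ℝ) : (polyP p).eval x = evP x p := by
  simp [polyP, evP, Polynomial.eval_finsetSum]

/-- The finite set of real roots. -/
def rts {n : ℕ} (p : Fin n → ℝ) : Finset ℝ := (polyP p).roots.toFinset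

@[simp]
theorem mem_rts {n : ℕ} {p : Fin n → ℝ} {x : ℝ} : x ∈ rts p ↔ evP x p = 0 := by
  simp [rts, (polyP_monic p).ne_zero, eval_polyP]

theorem card_rts_le {n : ℕ} (p : Fin n → ℝ) : (rts p).card ≤ n := by
  refine (Multiset.toFinset_card_le _).trans ((Polynomial.card_roots' _).trans ?_)
  rw [natDegree_polyP]

theorem evQ_coeff {n : ℕ} {f : Polynomial ℝ} (hf : f.natDegree < n) (x : ℝ) :
    evQ x (fun i : Fin n => (f.coeff i : ℂ)) = ((f.eval x : ℝ) : ℂ) := by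
  rw [evQ_apply, Polynomial.eval_eq_sum_range' hf, Finset.sum_range]
  push_cast
  exact Finset.sum_congr rfl fun i _ => mul_comm _ _

/-- Interpolation polynomials at the real roots of `p`. -/
def rootBasis {n : ℕ} (p : Fin n → ℝ) (x : ℝ) : Fin n → ℂ :=
  fun i => ((Lagrange.basis (rts p) id x).coeff i : ℂ)

theorem evQ_rootBasis {n : ℕ} {p : Fin n → ℝ} {x y : ℝ} (hx : x ∈ rts p) (hy : y ∈ rts p) :
    evQ y (rootBasis p x) = if x = y then 1 else 0 := by
  unfold rootBasis
  have hc := Finset.card_pos.2 ⟨x, hx⟩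
  rw [evQ_coeff]
  · split_ifs with h
    · subst h
      have := Lagrange.eval_basis_self (v := (id : ℝ → ℝ)) (Set.injOn_id _) hx
      simp only [id] at this
      simp [this]
    · have := Lagrange.eval_basis_of_ne (v := (id : ℝ → ℝ)) h hy
      simp only [id] at this
      simp [this]
  · have h := Lagrange.natDegree_basis (v := (id : ℝ → ℝ)) (Set.injOn_id _) hx
    have h' := card_rts_le p
    omega

variable {n : ℕ} [NeZero n]

/-- The coefficients of a polynomial of degree `< n` which agrees with `a + b x` at the roots
of `p`. -/
def lin (p : Fin n → ℝ) (a b : ℂ) : Fin n → ℂ := fun i =>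
  (Pi.single (M := fun _ : Fin n => ℂ) 0 a i) +
    ((if (i : ℕ) = 1 then b else 0) + (if n = 1 then -(b * p i) else 0))

theorem evQ_single (x : ℝ) (a : ℂ) : evQ x (Pi.single (M := fun _ : Fin n => ℂ) 0 a) = a := by
  rw [evQ_apply, Finset.sum_eq_single (0 : Fin n)]
  · simp
  · intro b _ hb; simp [hb]
  · simp

theorem lin_zero (p : Fin n → ℝ) (a : ℂ) : lin p a 0 = Pi.single 0 a := by
  ext i; simp [lin]

theorem evQ_lin {p : Fin n → ℝ} {x : ℝ} (hx : evP x p = 0) (a b : ℂ) :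
    evQ x (lin p a b) = a + b * x := by
  have : lin p a b = Pi.single (M := fun _ : Fin n => ℂ) 0 a +
    fun i : Fin n => ((if (i : ℕ) = 1 then b else 0) + (if n = 1 then -(b * p i) else 0)) := rfl
  rw [this, map_add, evQ_single, evQ_apply]
  congr 1
  by_cases h : n = 1
  · subst h
    simp [evP] at hx ⊢
    have : (x : ℂ) = - p 0 := by
      rw [eq_neg_iff_add_eq_zero]; exact_mod_cast hx
    rw [this]; ring
  · have h2 : 1 < n := by have := NeZero.ne n; omega
    rw [Finset.sum_eq_single (⟨1, h2⟩ : Fin n)]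
    · simp [h, mul_comm]
    · intro b _ hb
      have : (b : ℕ) ≠ 1 := fun hb' => hb (Fin.ext hb')
      simp [h, this]
    · simp

@[fun_prop]
theorem Continuous.lin {Y : Type*} [TopologicalSpace Y] {p : Y → Fin n → ℝ} {a b : Y → ℂ}
    (hp : Continuous p) (ha : Continuous a) (hb : Continuous b) :
    Continuous fun y => lin (p y) (a y) (b y) := by
  refine continuous_pi fun i => ?_
  unfold _root_.lin
  refine Continuous.add ?_ (Continuous.add ?_ ?_)
  · by_cases h : i = 0
    · subst h; simpa using ha
    · simp [h, continuous_const]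
  · split_ifs <;> fun_prop
  · split_ifs <;> fun_prop

/-- The slice of `coprimeLocus` on which the second polynomial is constantly one. -/
def oneSlice : C(Fin n → ℝ, coprimeLocus n) where
  toFun p := ⟨(p, Pi.single 0 1), fun x _ => by simp only [evQ_single]; exact one_ne_zero⟩
  continuous_toFun := by fun_prop

@[simp]
theorem oneSlice_snd (p : Fin n → ℝ) : (oneSlice p).1.2 = Pi.single 0 1 := rfl

/-- A loop in the fibre over `p` together with winding numbers at the real roots of `p`. -/
def HasLog {p : Fin n → ℝ} (γ : Path (oneSlice p) (oneSlice p)) (k : ℝ → ℤ) : Prop :=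
  (∀ t, (γ t).1.1 = p) ∧ ∀ x, evP x p = 0 →
    ∃ μ : Path (0 : ℂ) (k x * (2 * Real.pi * Complex.I)), ∀ t, Complex.exp (μ t) = evQ x (γ t).1.2

theorem HasLog.refl (p : Fin n → ℝ) : HasLog (Path.refl (oneSlice p)) 0 :=
  ⟨fun _ => rfl, fun x _ => ⟨(Path.refl 0).cast rfl (by simp), fun t => by
    simp [evQ_single, Path.refl_apply]⟩⟩

theorem HasLog.trans {p : Fin n → ℝ} {γ γ' : Path (oneSlice p) (oneSlice p)} {k k' : ℝ → ℤ}
    (h : HasLog γ k) (h' : HasLog γ' k') : HasLog (γ.trans γ') (k + k') := by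
  refine ⟨fun t => ?_, fun x hx => ?_⟩
  · rw [Path.trans_apply]
    split_ifs
    · exact h.1 _
    · exact h'.1 _
  · obtain ⟨μ, hμ⟩ := h.2 x hx
    obtain ⟨μ', hμ'⟩ := h'.2 x hx
    refine ⟨(μ.trans ((μ'.map (f := fun z => k x * (2 * Real.pi * Complex.I) + z)
      (by fun_prop)).cast (by simp) rfl)).cast rfl (by simp; ring), fun t => ?_⟩
    simp only [Path.cast_coe, Path.trans_apply]
    split_ifs
    · exact hμ _
    · simp [Complex.exp_add, Complex.exp_int_mul_two_pi_mul_I, hμ']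

theorem exists_log_path {γ : unitInterval → ℂ} (hγ : Continuous γ) (h0 : ∀ t, γ t ≠ 0)
    (hs : γ 0 = 1) : ∃ μ : C(unitInterval, ℂ), μ 0 = 0 ∧ ∀ t, Complex.exp (μ t) = γ t := by
  let g : C(unitInterval, {z : ℂ // z ≠ 0}) := ⟨fun t => ⟨γ t, h0 t⟩, by fun_prop⟩
  have hg : g 0 = ⟨_, (0 : ℂ).exp_ne_zero⟩ := by
    apply Subtype.ext; simp [g, hs]
  refine ⟨Complex.isCoveringMap_exp.liftPath g 0 hg, Complex.isCoveringMap_exp.liftPath_zero .., ?_⟩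
  intro t
  have := congrFun (Complex.isCoveringMap_exp.liftPath_lifts g 0 hg) t
  exact congrArg Subtype.val this

theorem exists_hasLog {p : Fin n → ℝ} (γ : Path (oneSlice p) (oneSlice p))
    (h : ∀ t, (γ t).1.1 = p) : ∃ k, HasLog γ k := by
  have H : ∀ x, ∃ k : ℤ, evP x p = 0 → ∃ μ : Path (0 : ℂ) (k * (2 * Real.pi * Complex.I)),
      ∀ t, Complex.exp (μ t) = evQ x (γ t).1.2 := by
    intro x
    by_cases hx : evP x p = 0
    · obtain ⟨μ, h0, hμ⟩ := exists_log_path (γ := fun t => evQ x (γ t).1.2) (by fun_prop)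
        (fun t => (γ t).2 x (by rw [h t, hx])) (by simp [evQ_single])
      have h1 := hμ 1
      simp only [Path.target, oneSlice_snd, evQ_single] at h1
      obtain ⟨k, hk⟩ := Complex.exp_eq_one_iff.1 h1
      exact ⟨k, fun _ => ⟨⟨μ, h0, hk⟩, hμ⟩⟩
    · exact ⟨0, fun h => absurd h hx⟩
  choose k hk using H
  exact ⟨k, h, hk⟩

theorem HasLog.homotopic {p : Fin n → ℝ} {γ γ' : Path (oneSlice p) (oneSlice p)} {k k' : ℝ → ℤ}
    (h : HasLog γ k) (h' : HasLog γ' k') (hk : ∀ x, evP x p = 0 → k x = k' x) :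
    γ.Homotopic γ' := by
  obtain ⟨h1, h2⟩ := h
  obtain ⟨h1', h2'⟩ := h'
  have h2 : ∀ x : rts p, _ := fun x => h2 x (mem_rts.1 x.2)
  have h2' : ∀ x : rts p, _ := fun x => h2' x (mem_rts.1 x.2)
  choose μ hμ using h2
  choose μ' hμ' using h2'
  let E : unitInterval → unitInterval → rts p → ℂ := fun τ t x =>
    Complex.exp ((1 - (τ : ℂ)) * μ x t + τ * μ' x t)
  let A : unitInterval → unitInterval → Fin n → ℂ := fun τ t =>
    (1 - (τ : ℂ)) • (γ t).1.2 + (τ : ℂ) • (γ' t).1.2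
  let q : unitInterval → unitInterval → Fin n → ℂ := fun τ t =>
    A τ t + ∑ x : rts p, (E τ t x - evQ x.1 (A τ t)) • rootBasis p x
  have hq : ∀ τ t x, evP x p = 0 → evQ x (q τ t) ≠ 0 := by
    intro τ t x hx
    have hx' := mem_rts.2 hx
    have : evQ x (q τ t) = E τ t ⟨x, hx'⟩ := by
      simp only [q, map_add, map_sum, LinearMap.map_smul]
      rw [Finset.sum_eq_single (⟨x, hx'⟩ : rts p)]
      · simp [evQ_rootBasis hx' hx']
      · intro b _ hb
        have : b.1 ≠ x := fun h => hb (Subtype.ext h)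
        simp [evQ_rootBasis b.2 hx', this]
      · simp
    rw [this]
    exact Complex.exp_ne_zero _
  have hend : ∀ τ t, A τ t = Pi.single 0 1 → (∀ x, E τ t x = 1) → q τ t = Pi.single 0 1 := by
    intro τ t h h'
    simp only [q, h, h', evQ_single]
    simp
  have hA0 : ∀ τ, A τ 0 = Pi.single 0 1 := by
    intro τ; simp only [A, Path.source, oneSlice_snd, ← add_smul, sub_add_cancel, one_smul]
  have hA1 : ∀ τ, A τ 1 = Pi.single 0 1 := by
    intro τ; simp only [A, Path.target, oneSlice_snd, ← add_smul, sub_add_cancel, one_smul]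
  have hE0 : ∀ τ x, E τ 0 x = 1 := by
    intro τ x; simp [E]
  have hE1 : ∀ τ x, E τ 1 x = 1 := by
    intro τ x
    have : (1 - (τ : ℂ)) * μ x 1 + τ * μ' x 1 = k x * (2 * Real.pi * Complex.I) := by
      rw [Path.target, Path.target, ← hk x (mem_rts.1 x.2)]; ring
    simp only [E, this, Complex.exp_int_mul_two_pi_mul_I]
  refine ⟨⟨⟨⟨fun z => ⟨(p, q z.1 z.2), hq _ _⟩, ?_⟩, ?_, ?_⟩, ?_⟩⟩
  · have : Continuous fun z : unitInterval × unitInterval => q z.1 z.2 := by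
      simp only [q, E, A]
      fun_prop
    fun_prop
  · intro t
    refine Subtype.ext (Prod.ext (h1 t).symm ?_)
    simp [q, A, E, hμ]
  · intro t
    refine Subtype.ext (Prod.ext (h1' t).symm ?_)
    simp [q, A, E, hμ']
  · rintro τ t (rfl | rfl)
    · refine Subtype.ext (Prod.ext (h1 0).symm ?_)
      simpa using hend τ 0 (hA0 τ) (hE0 τ)
    · refine Subtype.ext (Prod.ext (h1 1).symm ?_)
      simpa using hend τ 1 (hA1 τ) (hE1 τ)

end

section

theorem sub_ne_zero_of_root {n : ℕ} {p : Fin n → ℝ} {x c : ℝ} (hx : evP x p = 0) (hc : evP c p ≠ 0) :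
    x - c ≠ 0 := by
  rintro h
  rw [sub_eq_zero] at h
  exact hc (h ▸ hx)

theorem evP_zero {n : ℕ} (x : ℝ) : evP x (0 : Fin n → ℝ) = x ^ n := by simp [evP]

variable {n : ℕ} [NeZero n]

/-- The factor `exp (2 π i m t)`. -/
def turn (m : ℤ) (t : unitInterval) : ℂ := Complex.exp (m * (2 * Real.pi * Complex.I) * t)

theorem norm_turn (m : ℤ) (t : unitInterval) : ‖turn m t‖ = 1 := by
  have : (m * (2 * Real.pi * Complex.I) * t : ℂ) =
      ((m * (2 * Real.pi) * t : ℝ) : ℂ) * Complex.I := by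
    push_cast; ring
  rw [turn, this, Complex.norm_exp_ofReal_mul_I]

@[simp]
theorem turn_at_zero (m : ℤ) : turn m 0 = 1 := by simp [turn]

@[simp]
theorem turn_at_one (m : ℤ) : turn m 1 = 1 := by simp [turn, Complex.exp_int_mul_two_pi_mul_I]

@[fun_prop]
theorem continuous_turn (m : ℤ) : Continuous (turn m) := by unfold turn; fun_prop

/-- The value at distance `y` from the turning point. -/
def turnVal (m : ℤ) (y : ℝ) (t : unitInterval) : ℂ := (turn m t * (1 - y) + (1 + y)) / 2

theorem mix_re_pos {e : ℂ} (he : ‖e‖ = 1) {y : ℝ} (hy : 0 < y) :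
    0 < ((e * (1 - y) + (1 + y)) / 2 : ℂ).re := by
  have h1 := Complex.abs_re_le_norm e
  rw [he, abs_le] at h1
  have : ((e * (1 - y) + (1 + y)) / 2 : ℂ) =
      ((1 / 2 : ℝ) : ℂ) * (((1 - y : ℝ) : ℂ) * e + ((1 + y : ℝ) : ℂ)) := by
    push_cast; ring
  rw [this, Complex.re_ofReal_mul, Complex.add_re, Complex.re_ofReal_mul, Complex.ofReal_re]
  rcases le_total y 1 with h | h <;> nlinarith

theorem turnVal_log (m : ℤ) {y : ℝ} (hy : y ≠ 0) :
    ∃ μ : Path (0 : ℂ) ((if y < 0 then m else 0 : ℤ) * (2 * Real.pi * Complex.I)),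
      ∀ t, Complex.exp (μ t) = turnVal m y t := by
  rcases lt_or_gt_of_ne hy with h | h
  · have hre : ∀ t, ((turn (-m) t * (1 - (-y : ℝ)) + (1 + (-y : ℝ))) / 2 : ℂ) ∈ Complex.slitPlane :=
      fun t => Or.inl (mix_re_pos (norm_turn (-m) t) (neg_pos.2 h))
    refine ⟨⟨⟨fun t => m * (2 * Real.pi * Complex.I) * t +
      Complex.log ((turn (-m) t * (1 - (-y : ℝ)) + (1 + (-y : ℝ))) / 2), ?_⟩, ?_, ?_⟩, ?_⟩
    · exact Continuous.add (by fun_prop) (Continuous.clog (by fun_prop) hre)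
    · simp; ring_nf; simp
    · simp [h]; ring_nf; simp
    · intro t
      have hinv : turn m t * turn (-m) t = 1 := by
        rw [turn, turn, ← Complex.exp_add]; push_cast; ring_nf; simp
      simp only [Path.coe_mk_mk, Complex.exp_add]
      rw [Complex.exp_log (Complex.slitPlane_ne_zero (hre t))]
      change turn m t * _ = _
      rw [turnVal]
      push_cast
      linear_combination (1 + y : ℂ) / 2 * hinv
  · have hre : ∀ t, turnVal m y t ∈ Complex.slitPlane :=
      fun t => Or.inl (mix_re_pos (norm_turn m t) h)
    refine ⟨⟨⟨fun t => Complex.log (turnVal m y t), ?_⟩, ?_, ?_⟩, ?_⟩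
    · refine Continuous.clog ?_ hre
      unfold turnVal; fun_prop
    · simp [turnVal]
    · simp [turnVal, h.not_gt]
    · intro t
      simp only [Path.coe_mk_mk]
      rw [Complex.exp_log (Complex.slitPlane_ne_zero (hre t))]

theorem turnVal_ne_zero (m : ℤ) {y : ℝ} (hy : y ≠ 0) (t : unitInterval) : turnVal m y t ≠ 0 := by
  obtain ⟨μ, hμ⟩ := turnVal_log m hy
  rw [← hμ]
  exact Complex.exp_ne_zero _

/-- The coefficients of the second polynomial of `elemLoop`. -/
def elemQ (m : ℤ) (p : Fin n → ℝ) (c : ℝ) (t : unitInterval) : Fin n → ℂ :=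
  lin p ((turn m t * (1 + c) + (1 - c)) / 2) ((1 - turn m t) / 2)

theorem evQ_elemQ (m : ℤ) {p : Fin n → ℝ} {x : ℝ} (hx : evP x p = 0) (c : ℝ) (t : unitInterval) :
    evQ x (elemQ m p c t) = turnVal m (x - c) t := by
  rw [elemQ, evQ_lin hx, turnVal]
  push_cast
  ring

/-- The fibre loop winding `m` times around zero at the roots of `p` below `c`. -/
def elemLoop (m : ℤ) (p : Fin n → ℝ) (c : ℝ) (hc : evP c p ≠ 0) :
    Path (oneSlice p) (oneSlice p) where
  toFun t := ⟨(p, elemQ m p c t), fun x hx => by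
    simp only [evQ_elemQ m hx]
    exact turnVal_ne_zero m (sub_ne_zero_of_root hx hc) t⟩
  continuous_toFun := by
    unfold elemQ
    fun_prop
  source' := by
    refine Subtype.ext (Prod.ext rfl ?_)
    simp only [elemQ, turn_at_zero, oneSlice_snd, sub_self, zero_div, lin_zero]
    congr 1; ring
  target' := by
    refine Subtype.ext (Prod.ext rfl ?_)
    simp only [elemQ, turn_at_one, oneSlice_snd, sub_self, zero_div, lin_zero]
    congr 1; ring

theorem hasLog_elemLoop (m : ℤ) (p : Fin n → ℝ) (c : ℝ) (hc : evP c p ≠ 0) :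
    HasLog (elemLoop m p c hc) fun x => if x < c then m else 0 := by
  refine ⟨fun _ => rfl, fun x hx => ?_⟩
  obtain ⟨μ, hμ⟩ := turnVal_log m (sub_ne_zero_of_root hx hc)
  refine ⟨μ.cast rfl (by simp only [sub_neg]), fun t => ?_⟩
  simp only [Path.cast_coe, hμ, elemLoop, Path.coe_mk_mk, evQ_elemQ m hx]

/-- The polynomial `X ^ n - (-1) ^ n`. -/
def pstar (n : ℕ) [NeZero n] : Fin n → ℝ := Pi.single 0 (-(-1) ^ n)

/-- Addition of a constant to a polynomial. -/
def shiftP (p : Fin n → ℝ) (K : ℝ) : Fin n → ℝ := p + Pi.single 0 K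

@[fun_prop]
theorem Continuous.shiftP {Y : Type*} [TopologicalSpace Y] {p : Y → Fin n → ℝ} {K : Y → ℝ}
    (hp : Continuous p) (hK : Continuous K) : Continuous fun y => shiftP (p y) (K y) :=
  hp.add ((continuous_single (A := fun _ : Fin n => ℝ) 0).comp hK)

theorem evP_shiftP (x : ℝ) (p : Fin n → ℝ) (K : ℝ) : evP x (shiftP p K) = evP x p + K := by
  simp only [shiftP, evP, Pi.add_apply, add_mul, Finset.sum_add_distrib, ← add_assoc]
  congr 1
  rw [Finset.sum_eq_single (0 : Fin n)]
  · simp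
  · intro b _ hb; simp [hb]
  · simp

theorem evP_pstar (x : ℝ) : evP x (pstar n) = x ^ n - (-1) ^ n := by
  have := evP_shiftP x (0 : Fin n → ℝ) (-(-1 : ℝ) ^ n)
  rw [evP_zero, shiftP, zero_add] at this
  rw [pstar, this]; ring

theorem evP_zero_pstar : evP 0 (pstar n) = -(-1) ^ n := by
  simp [evP_pstar, NeZero.ne n]

theorem evP_zero_pstar_ne : evP 0 (pstar n) ≠ 0 := by
  simp [evP_zero_pstar]

/-- The class of an elementary loop at the base point. -/
def elemClass (m : ℤ) (p : Fin n → ℝ) (c : ℝ) (hc : evP c p ≠ 0) :=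
  sliceClass oneSlice (pstar n) (elemLoop m p c hc)

theorem elemClass_family (m : ℤ) {p : unitInterval → Fin n → ℝ} {c : unitInterval → ℝ}
    (hp : Continuous p) (hc : Continuous c) (h : ∀ s, evP (c s) (p s) ≠ 0) :
    elemClass m (p 0) (c 0) (h 0) = elemClass m (p 1) (c 1) (h 1) := by
  refine sliceClass_family oneSlice (pstar n) hp hp (fun s => elemLoop m (p s) (c s) (h s)) ?_
  refine Continuous.subtype_mk (f := fun z : unitInterval × unitInterval =>
    (p z.1, elemQ m (p z.1) (c z.1) z.2)) ?_ _
  unfold elemQ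
  fun_prop

theorem elemClass_shift (m : ℤ) {p : Fin n → ℝ} {c σ K : ℝ} (h : 0 < σ * evP c p)
    (h' : evP c p ≠ 0) (hs : evP c (shiftP p (σ * K)) ≠ 0) (hK : 0 ≤ K) :
    elemClass m p c h' = elemClass m (shiftP p (σ * K)) c hs := by
  have key : ∀ s : unitInterval,
      evP c (shiftP p (σ * ((s : ℝ) * K))) ≠ 0 := by
    intro s hs
    have h1 := evP_shiftP c p (σ * ((s : ℝ) * K))
    have h2 : 0 ≤ σ ^ 2 * ((s : ℝ) * K) := mul_nonneg (sq_nonneg σ) (mul_nonneg s.2.1 hK)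
    have h3 : σ * evP c p + σ ^ 2 * (s * K) = 0 := by linear_combination σ * hs - σ * h1
    linarith
  have := elemClass_family m (p := fun s => shiftP p (σ * ((s : ℝ) * K))) (c := fun _ => c)
    (by fun_prop) continuous_const key
  simpa [shiftP] using this

theorem elemClass_eq (m : ℤ) {p p' : Fin n → ℝ} {c c' σ : ℝ}
    (h : 0 < σ * evP c p) (h' : 0 < σ * evP c' p')
    (hc : evP c p ≠ 0) (hc' : evP c' p' ≠ 0) :
    elemClass m p c hc = elemClass m p' c' hc' := by
  let f : unitInterval → ℝ := fun s =>
    σ * evP (c + s * (c' - c)) (p + (s : ℝ) • (p' - p))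
  have hf : Continuous f := by fun_prop
  obtain ⟨B, hB⟩ := (isCompact_range hf).bddBelow
  have hσ : 0 < σ ^ 2 := by
    have : σ ≠ 0 := by rintro rfl; simp at h
    positivity
  let K := (|B| + 1) / σ ^ 2
  have hK : 0 ≤ K := by positivity
  have hKσ : σ ^ 2 * K = |B| + 1 := by
    exact mul_div_cancel₀ _ hσ.ne'
  have key : ∀ s : unitInterval,
      evP (c + s * (c' - c)) (shiftP (p + (s : ℝ) • (p' - p)) (σ * K)) ≠ 0 := by
    intro s hs
    rw [evP_shiftP] at hs
    have h1 : f s + σ ^ 2 * K = 0 := by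
      simp only [f]; linear_combination σ * hs
    have h2 : B ≤ f s := hB ⟨s, rfl⟩
    have := neg_abs_le B
    linarith
  have k0 : evP c (shiftP p (σ * K)) ≠ 0 := by simpa using key 0
  have k1 : evP c' (shiftP p' (σ * K)) ≠ 0 := by simpa using key 1
  rw [elemClass_shift m h hc k0 hK, elemClass_shift m h' hc' k1 hK]
  have := elemClass_family m (p := fun s => shiftP (p + (s : ℝ) • (p' - p)) (σ * K))
    (c := fun s => c + s * (c' - c)) (by fun_prop) (by fun_prop) key
  simpa using this

/-- The class of the generating loop, traversed `m` times. -/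
def genClass (n : ℕ) [NeZero n] (m : ℤ) :
    Path.Homotopic.Quotient (oneSlice (pstar n)) (oneSlice (pstar n)) :=
  .mk (elemLoop m (pstar n) 0 evP_zero_pstar_ne)

theorem genClass_trans (m m' : ℤ) :
    (genClass n m).trans (genClass n m') = genClass n (m + m') := by
  rw [genClass, genClass, genClass, ← Path.Homotopic.Quotient.mk_trans]
  refine Path.Homotopic.Quotient.eq.2
    (((hasLog_elemLoop _ _ _ _).trans (hasLog_elemLoop _ _ _ _)).homotopic
      (hasLog_elemLoop _ _ _ _) fun x _ => ?_)
  simp only [Pi.add_apply]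
  split_ifs <;> simp

theorem genClass_zero : genClass n 0 = .refl _ := by
  rw [genClass, ← Path.Homotopic.Quotient.mk_refl]
  exact Path.Homotopic.Quotient.eq.2
    ((hasLog_elemLoop _ _ _ _).homotopic (HasLog.refl _) fun x _ => by simp)

theorem elemClass_mem_range (m : ℤ) (p : Fin n → ℝ) (c : ℝ) (hc : evP c p ≠ 0) :
    ∃ m', elemClass m p c hc = genClass n m' := by
  have h1 : ((-1 : ℝ) ^ n) * (-1) ^ n = 1 := by rw [← mul_pow]; simp
  have hne : (-1 : ℝ) ^ n * evP c p ≠ 0 := mul_ne_zero (by simp) hc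
  rcases lt_or_gt_of_ne hne with h | h
  · refine ⟨m, ?_⟩
    rw [genClass, ← sliceClass_base]
    refine elemClass_eq (σ := -(-1) ^ n) m (by linarith) ?_ _ _
    rw [evP_zero_pstar]; linarith
  · refine ⟨0, ?_⟩
    have hc' : evP (-1) (0 : Fin n → ℝ) ≠ 0 := by simp [evP_zero]
    rw [elemClass_eq (σ := (-1) ^ n) (p' := 0) (c' := -1) m h (by rw [evP_zero, h1]; exact one_pos)
      hc hc', genClass_zero, elemClass, ← sliceClass_refl oneSlice (pstar n) 0]
    refine sliceClass_congr _ _ ((hasLog_elemLoop _ _ _ _).homotopic (HasLog.refl _) fun x hx => ?_)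
    rw [evP_zero] at hx
    have : x = 0 := by simpa [NeZero.ne n] using hx
    subst this
    norm_num

theorem HasLog.class_mem_range {p : Fin n → ℝ} {γ : Path (oneSlice p) (oneSlice p)} {k : ℝ → ℤ}
    (h : HasLog γ k) : ∃ m, sliceClass oneSlice (pstar n) γ = genClass n m := by
  classical
  let S : (ℝ → ℤ) → Finset ℝ := fun k => {x ∈ rts p | ∃ x' ∈ rts p, x ≤ x' ∧ k x' ≠ 0}
  induction hN : (S k).card using Nat.strong_induction_on generalizing γ k with
  | _ N ih =>
    rcases (S k).eq_empty_or_nonempty with he | hne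
    · refine ⟨0, ?_⟩
      rw [genClass_zero, ← sliceClass_refl oneSlice (pstar n) p]
      refine sliceClass_congr _ _ (h.homotopic (HasLog.refl _) fun x hx => ?_)
      by_contra hk
      have : x ∈ S k := Finset.mem_filter.2 ⟨mem_rts.2 hx, x, mem_rts.2 hx, le_rfl, hk⟩
      simp [he] at this
    · obtain ⟨z, hz, hmax⟩ := (S k).exists_max_image id hne
      replace hmax : ∀ x ∈ S k, x ≤ z := hmax
      obtain ⟨hzr, z', hz'r, hzz', hkz'⟩ := Finset.mem_filter.1 hz
      have hz' : z' = z :=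
        le_antisymm (hmax z' (Finset.mem_filter.2 ⟨hz'r, z', hz'r, le_rfl, hkz'⟩)) hzz'
      subst hz'
      have hev : ∀ᶠ c in nhdsWithin z' (Set.Ioi z'), ∀ x ∈ rts p, z' < x → c < x := by
        refine (Finset.eventually_all _).2 fun x _ => ?_
        by_cases hx : z' < x
        · filter_upwards [nhdsWithin_le_nhds (Iio_mem_nhds hx)] with c hc _ using hc
        · simp [hx]
      obtain ⟨c, hc, hzc⟩ := (hev.and self_mem_nhdsWithin).exists
      replace hzc : z' < c := hzc
      have hcp : evP c p ≠ 0 := fun h0 => lt_irrefl c (hc c (mem_rts.2 h0) hzc)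
      have h1 := h.trans (hasLog_elemLoop (-k z') p c hcp)
      have h2 := h1.trans (hasLog_elemLoop (k z') p c hcp)
      have hlt : (S (k + fun x => if x < c then -k z' else 0)).card < N := by
        rw [← hN]
        refine Finset.card_lt_card ((Finset.ssubset_iff_of_subset ?_).2 ⟨z', hz, ?_⟩)
        · intro x hx
          obtain ⟨hxr, x', hx'r, hxx', hk⟩ := Finset.mem_filter.1 hx
          refine Finset.mem_filter.2 ⟨hxr, ?_⟩
          rcases lt_or_ge z' x' with hl | hl
          · have := hc x' hx'r hl
            exact ⟨x', hx'r, hxx', by simpa [this.not_gt] using hk⟩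
          · exact ⟨z', hzr, hxx'.trans hl, hkz'⟩
        · intro hx
          obtain ⟨hxr, x', hx'r, hxx', hk⟩ := Finset.mem_filter.1 hx
          rcases hxx'.eq_or_lt with rfl | hl
          · simp [hzc] at hk
          · have := hc x' hx'r hl
            have hk' : k x' ≠ 0 := by simpa [this.not_gt] using hk
            exact absurd (hmax x' (Finset.mem_filter.2 ⟨hx'r, x', hx'r, le_rfl, hk'⟩)) hl.not_ge
      obtain ⟨m1, hm1⟩ := ih _ hlt h1 rfl
      obtain ⟨m2, hm2⟩ := elemClass_mem_range (k z') p c hcp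
      refine ⟨m1 + m2, ?_⟩
      rw [← genClass_trans, ← hm1, ← hm2, elemClass, ← sliceClass_trans]
      refine sliceClass_congr _ _ (h.homotopic h2 fun x _ => ?_)
      simp only [Pi.add_apply]
      split_ifs <;> simp

theorem fibre_class_mem_range {p : Fin n → ℝ} (γ : Path (oneSlice p) (oneSlice p))
    (h : ∀ t, (γ t).1.1 = p) : ∃ m, sliceClass oneSlice (pstar n) γ = genClass n m := by
  obtain ⟨k, hk⟩ := exists_hasLog γ h
  exact hk.class_mem_range

end

section

variable {n : ℕ}

theorem abs_root_le {p : Fin n → ℝ} {x : ℝ} (hx : evP x p = 0) : |x| ≤ 1 + ∑ i, |p i| := by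
  by_contra! h
  have hs : 0 ≤ ∑ i, |p i| := Finset.sum_nonneg fun _ _ => abs_nonneg _
  have h1 : 1 < |x| := by linarith
  have h2 : |x| ^ n ≤ ∑ i, |p i| * |x| ^ (n - 1) := by
    have : x ^ n = -∑ i, p i * x ^ (i : ℕ) := by rw [evP] at hx; linarith
    rw [← abs_pow, this, abs_neg]
    refine (Finset.abs_sum_le_sum_abs _ _).trans (Finset.sum_le_sum fun i _ => ?_)
    rw [abs_mul, abs_pow]
    exact mul_le_mul_of_nonneg_left (pow_le_pow_right₀ h1.le (by have := i.2; omega))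
      (abs_nonneg _)
  rw [← Finset.sum_mul] at h2
  rcases n with _ | n
  · simp at h2; linarith
  · rw [pow_succ', Nat.add_sub_cancel] at h2
    have := le_of_mul_le_mul_right h2 (by positivity)
    linarith

/-- Multiplication by `exp w` moves the values at the roots off the negative real axis. -/
def Adm (w : ℂ) (y : coprimeLocus n) : Prop :=
  ∀ x, evP x y.1.1 = 0 → Complex.exp w * evQ x y.1.2 ∈ Complex.slitPlane

theorem exists_adm (y : coprimeLocus n) : ∃ w, Adm w y := by
  classical
  obtain ⟨θ, hθ, hB⟩ := (Set.Ioo_infinite (neg_lt_self Real.pi_pos)).exists_notMem_finset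
    ((rts y.1.1).image fun x => Complex.arg (-(‖evQ x y.1.2‖ : ℂ) / evQ x y.1.2))
  refine ⟨θ * Complex.I, fun x hx => ?_⟩
  by_contra h
  refine hB (Finset.mem_image.2 ⟨x, mem_rts.2 hx, ?_⟩)
  have hv := y.2 x hx
  set v := evQ x y.1.2
  rw [Complex.mem_slitPlane_iff_arg, not_and_or, not_not, not_not] at h
  have hne : Complex.exp (θ * Complex.I) * v ≠ 0 := mul_ne_zero (Complex.exp_ne_zero _) hv
  have h := h.resolve_right hne
  have h2 := Complex.norm_mul_exp_arg_mul_I (Complex.exp (θ * Complex.I) * v)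
  rw [h, Complex.exp_pi_mul_I, norm_mul, Complex.norm_exp_ofReal_mul_I, one_mul] at h2
  have h3 : -(‖v‖ : ℂ) / v = Complex.exp (θ * Complex.I) := by
    rw [div_eq_iff hv, ← h2]; ring
  rw [h3, Complex.arg_exp_mul_I, toIocMod_eq_self]
  exact ⟨hθ.1, by linarith [hθ.2]⟩

theorem isOpen_adm (w : ℂ) : IsOpen {y : coprimeLocus n | Adm w y} := by
  rw [isOpen_iff_mem_nhds]
  intro y hy
  have h1 : ∀ᶠ z : coprimeLocus n in nhds y, ∑ i, |z.1.1 i| < ∑ i, |y.1.1 i| + 1 := by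
    have : Continuous fun z : coprimeLocus n => ∑ i, |z.1.1 i| := by fun_prop
    exact (this.tendsto y).eventually (gt_mem_nhds (lt_add_one _))
  have h2 : ∀ᶠ z : coprimeLocus n in nhds y,
      ∀ x ∈ Set.Icc (-(2 + ∑ i, |y.1.1 i|)) (2 + ∑ i, |y.1.1 i|),
        (evP x z.1.1 ≠ 0 ∨ Complex.exp w * evQ x z.1.2 ∈ Complex.slitPlane) := by
    refine isCompact_Icc.eventually_forall_of_forall_eventually fun x _ => ?_
    have c1 : Continuous fun z : coprimeLocus n × ℝ => evP z.2 z.1.1.1 := by fun_prop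
    have c2 : Continuous fun z : coprimeLocus n × ℝ => Complex.exp w * evQ z.2 z.1.1.2 := by
      fun_prop
    have : IsOpen {z : coprimeLocus n × ℝ |
        evP z.2 z.1.1.1 ≠ 0 ∨ Complex.exp w * evQ z.2 z.1.1.2 ∈ Complex.slitPlane} :=
      (isOpen_ne.preimage c1).union (Complex.isOpen_slitPlane.preimage c2)
    refine this.mem_nhds ?_
    by_cases hx : evP x y.1.1 = 0
    · exact Or.inr (hy x hx)
    · exact Or.inl hx
  filter_upwards [h1, h2] with z hz1 hz2 x hx
  refine (hz2 x ?_).resolve_left (not_not.2 hx)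
  have := abs_le.1 (abs_root_le hx)
  constructor <;> linarith

variable [NeZero n]

/-- A path inside the fibre from `y` to the slice. -/
def toSlice (w : ℂ) (y : coprimeLocus n) (hw : Adm w y) : Path y (oneSlice y.1.1) where
  toFun s := ⟨(y.1.1, Complex.exp (-((1 - (s : ℂ)) * w)) •
      ((1 - (s : ℝ)) • (Complex.exp w • y.1.2) + (s : ℝ) • (Pi.single 0 1 : Fin n → ℂ))),
      fun x hx => by
    have : ((1 - (s : ℝ)) • (Complex.exp w * evQ x y.1.2) + (s : ℝ) • (1 : ℂ)) ∈
        Complex.slitPlane := by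
      have := (starConvex_iff_segment_subset.1 Complex.starConvex_one_slitPlane) (hw x hx)
      exact this ⟨s, 1 - s, s.2.1, sub_nonneg.2 s.2.2, by ring, add_comm _ _⟩
    rw [LinearMap.map_smul, map_add, LinearMap.map_smul_of_tower, LinearMap.map_smul_of_tower,
      LinearMap.map_smul_of_tower, evQ_single, smul_eq_mul, smul_eq_mul]
    exact mul_ne_zero (Complex.exp_ne_zero _) (Complex.slitPlane_ne_zero this)⟩
  continuous_toFun := by fun_prop
  source' := by
    refine Subtype.ext (Prod.ext rfl ?_)
    simp [smul_smul, ← Complex.exp_add]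
  target' := by
    refine Subtype.ext (Prod.ext rfl ?_)
    simp

theorem toSlice_fst (w : ℂ) (y : coprimeLocus n) (hw : Adm w y) (s : unitInterval) :
    (toSlice w y hw s).1.1 = y.1.1 := rfl

theorem trans_toSlice_fst {w : ℂ} {y z : coprimeLocus n} (δ : Path z y) (hw : Adm w y)
    (h : ∀ t, (δ t).1.1 = y.1.1) (t : unitInterval) :
    (δ.trans (toSlice w y hw) t).1.1 = y.1.1 := by
  rw [Path.trans_apply]
  split_ifs
  · rw [h]
  · rfl

theorem adm_zero (p : Fin n → ℝ) : Adm 0 (oneSlice p) := fun x _ => by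
  simp [evQ_single]

theorem toSlice_zero (p : Fin n → ℝ) : toSlice 0 (oneSlice p) (adm_zero p) = Path.refl _ := by
  refine Path.ext (funext fun s => Subtype.ext (Prod.ext rfl ?_))
  change _ = (oneSlice p).1.2
  simp only [toSlice, Path.coe_mk_mk, mul_zero, neg_zero, Complex.exp_zero, one_smul, oneSlice_snd,
    ← add_smul, sub_add_cancel]

/-- The class of a path starting at the base point, closed up along a fibre and the slice. -/
def endClass (w : ℂ) {y : coprimeLocus n} (hw : Adm w y) (δ : Path (oneSlice (pstar n)) y) :=
  sliceClass oneSlice (pstar n) (δ.trans (toSlice w y hw))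

theorem endClass_mem_range_congr {w w' : ℂ} {y : coprimeLocus n} (hw : Adm w y) (hw' : Adm w' y)
    (δ : Path (oneSlice (pstar n)) y) (h : ∃ m, endClass w hw δ = genClass n m) :
    ∃ m, endClass w' hw' δ = genClass n m := by
  obtain ⟨m, hm⟩ := h
  obtain ⟨m', hm'⟩ := fibre_class_mem_range ((toSlice w y hw).symm.trans (toSlice w' y hw'))
    (fun t => by
      rw [Path.trans_apply]
      split_ifs <;> simp [toSlice_fst])
  refine ⟨m + m', ?_⟩
  rw [← genClass_trans, ← hm, ← hm', endClass, endClass, ← sliceClass_trans]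
  refine sliceClass_congr _ _ (Path.Homotopic.Quotient.eq.1 ?_)
  simp only [Path.Homotopic.Quotient.mk_trans, Path.Homotopic.Quotient.mk_symm,
    Path.Homotopic.Quotient.trans_assoc]
  rw [← Path.Homotopic.Quotient.trans_assoc (.mk (toSlice w y hw)),
    Path.Homotopic.Quotient.trans_symm, Path.Homotopic.Quotient.refl_trans]

theorem endClass_base (δ : Path (oneSlice (pstar n)) (oneSlice (pstar n))) :
    endClass 0 (adm_zero _) δ = .mk δ := by
  have : endClass 0 (adm_zero _) δ = .mk (δ.trans (toSlice 0 _ (adm_zero (pstar n)))) :=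
    sliceClass_base _ _ _
  rw [this, toSlice_zero, Path.Homotopic.Quotient.mk_trans, Path.Homotopic.Quotient.mk_refl,
    Path.Homotopic.Quotient.trans_refl]

/-- The initial part of a loop. -/
def initialPath (γ : Path (oneSlice (pstar n)) (oneSlice (pstar n))) (t : unitInterval) :
    Path (oneSlice (pstar n)) (γ t) :=
  (γ.subpath 0 t).cast γ.source.symm rfl

theorem continuous_initialPath (γ : Path (oneSlice (pstar n)) (oneSlice (pstar n))) :
    Continuous ↿(initialPath γ) :=
  (Path.subpath_continuous_family γ).comp
    (f := fun z : unitInterval × unitInterval => (0, z.1, z.2)) (by fun_prop)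

theorem endClass_family {w : ℂ} (γ : Path (oneSlice (pstar n)) (oneSlice (pstar n)))
    {τ : unitInterval → unitInterval} (hτ : Continuous τ) (h : ∀ s, Adm w (γ (τ s))) :
    endClass w (h 0) (initialPath γ (τ 0)) = endClass w (h 1) (initialPath γ (τ 1)) := by
  refine sliceClass_family oneSlice (pstar n) continuous_const
    (b := fun s => (γ (τ s)).1.1) (by fun_prop)
    (fun s => (initialPath γ (τ s)).trans (toSlice w _ (h s))) ?_
  refine Path.trans_continuous_family _ ?_ _ ?_
  · exact (continuous_initialPath γ).comp
      (f := fun z : unitInterval × unitInterval => (τ z.1, z.2)) (by fun_prop)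
  · refine Continuous.subtype_mk (f := fun z : unitInterval × unitInterval =>
      ((γ (τ z.1)).1.1, Complex.exp (-((1 - (z.2 : ℂ)) * w)) •
      ((1 - (z.2 : ℝ)) • (Complex.exp w • (γ (τ z.1)).1.2) +
        (z.2 : ℝ) • (Pi.single 0 1 : Fin n → ℂ)))) ?_ _
    fun_prop

theorem class_mem_range (γ : Path (oneSlice (pstar n)) (oneSlice (pstar n))) :
    ∃ m, .mk γ = genClass n m := by
  let P : unitInterval → Prop := fun t =>
    ∀ w, ∀ hw : Adm w (γ t), ∃ m, endClass w hw (initialPath γ t) = genClass n m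
  have hloc : IsLocallyConstant P := by
    rw [IsLocallyConstant.iff_eventually_eq]
    intro t
    obtain ⟨w, hw⟩ := exists_adm (γ t)
    have hU := ((isOpen_adm w).preimage γ.continuous).mem_nhds hw
    obtain ⟨ε, hε, hball⟩ := Metric.mem_nhds_iff.1 hU
    filter_upwards [Metric.ball_mem_nhds t hε] with t' ht'
    let τ : unitInterval → unitInterval := fun s =>
      ⟨t + s * (t' - t), by
        have := (convex_Icc (0 : ℝ) 1) t.2 t'.2 (sub_nonneg.2 s.2.2) s.2.1 (by ring)
        simp only [smul_eq_mul] at this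
        convert this using 1; ring⟩
    have hτ : Continuous τ := by fun_prop
    have hτ0 : τ 0 = t := Subtype.ext (by simp [τ])
    have hτ1 : τ 1 = t' := Subtype.ext (by simp [τ])
    have hadm : ∀ s, Adm w (γ (τ s)) := fun s => hball (by
      rw [Metric.mem_ball, Subtype.dist_eq, Real.dist_eq] at ht' ⊢
      have : ((τ s : ℝ) - t) = s * (t' - t) := by simp [τ]
      rw [this, abs_mul, abs_of_nonneg s.2.1]
      exact (mul_le_of_le_one_left (abs_nonneg _) s.2.2).trans_lt ht')
    have key : ∀ s, P (τ s) ↔ ∃ m, endClass w (hadm s) (initialPath γ (τ s)) = genClass n m :=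
      fun s => ⟨fun h => h w _, fun h w' hw' => endClass_mem_range_congr _ _ _ h⟩
    have := key 1
    rw [← endClass_family γ hτ hadm, ← key 0] at this
    rw [hτ0, hτ1] at this
    exact propext this
  have h0 : P 0 := by
    intro w hw
    have : ∀ y (_ : y = oneSlice (pstar n)) (δ : Path (oneSlice (pstar n)) y) (hw : Adm w y),
        (∀ t, δ t = oneSlice (pstar n)) → ∃ m, endClass w hw δ = genClass n m := by
      rintro y rfl δ hw hδ
      exact fibre_class_mem_range _ (trans_toSlice_fst δ hw fun t => by rw [hδ])
    refine this _ γ.source _ hw fun t => ?_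
    simp [initialPath]
  have h1 : P 1 := (hloc.apply_eq_of_preconnectedSpace 0 1) ▸ h0
  have : ∀ y (h : y = oneSlice (pstar n)) (δ : Path (oneSlice (pstar n)) y),
      (∀ w, ∀ hw : Adm w y, ∃ m, endClass w hw δ = genClass n m) →
      ∃ m, .mk (δ.cast rfl h.symm) = genClass n m := by
    rintro y rfl δ h
    obtain ⟨m, hm⟩ := h 0 (adm_zero _)
    exact ⟨m, by rw [← hm, endClass_base]; rfl⟩
  obtain ⟨m, hm⟩ := this _ γ.target _ h1
  refine ⟨m, ?_⟩
  rw [← hm]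
  congr 1
  ext t
  all_goals simp [initialPath]

instance : PathConnectedSpace (coprimeLocus n) := by
  have key : ∀ y : coprimeLocus n, Joined y (oneSlice (pstar n)) := fun y => by
    obtain ⟨w, hw⟩ := exists_adm y
    exact ⟨(toSlice w y hw).trans ((segPath y.1.1 (pstar n)).map oneSlice.continuous)⟩
  exact ⟨⟨oneSlice (pstar n)⟩, fun y z => (key y).trans (key z).symm⟩

end

section

/-- The Euclidean norm on `ℝ × ℂ`. -/
def rad (v : ℝ × ℂ) : ℝ := √(v.1 ^ 2 + ‖v.2‖ ^ 2)

/-- The positive matrix of rank one attached to a vector of `ℝ³ = ℝ × ℂ`, acting on spinors. -/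
def spinStep (v : ℝ × ℂ) (ψ : ℂ × ℂ) : ℂ × ℂ :=
  (((rad v : ℂ) + v.1) * ψ.1 + star v.2 * ψ.2, v.2 * ψ.1 + ((rad v : ℂ) - v.1) * ψ.2)

/-- Spinors in the line attached to a vector. -/
def IsSpinor (v : ℝ × ℂ) (ψ : ℂ × ℂ) : Prop :=
  ((rad v : ℂ) - v.1) * ψ.1 - star v.2 * ψ.2 = 0 ∧
    -v.2 * ψ.1 + ((rad v : ℂ) + v.1) * ψ.2 = 0

theorem rad_sq (v : ℝ × ℂ) : (rad v : ℂ) ^ 2 = (v.1 : ℂ) ^ 2 + v.2 * star v.2 := by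
  have h : rad v ^ 2 = v.1 ^ 2 + ‖v.2‖ ^ 2 := Real.sq_sqrt (by positivity)
  have h2 : v.2 * star v.2 = ((‖v.2‖ ^ 2 : ℝ) : ℂ) := by
    rw [← Complex.normSq_eq_norm_sq]; exact Complex.mul_conj _
  rw [h2]
  exact_mod_cast h

theorem isSpinor_spinStep (v : ℝ × ℂ) (ψ : ℂ × ℂ) : IsSpinor v (spinStep v ψ) := by
  have := rad_sq v
  constructor <;> simp only [spinStep]
  · linear_combination ψ.1 * this
  · linear_combination ψ.2 * this

theorem spinStep_ne_zero {u v : ℝ × ℂ} {ψ : ℂ × ℂ} (hu : IsSpinor u ψ) (hψ : ψ ≠ 0)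
    (h : (v.1 - u.1) ^ 2 + ‖v.2 - u.2‖ ^ 2 < (rad u + rad v) ^ 2) : spinStep v ψ ≠ 0 := by
  intro h0
  have e1 := congrArg Prod.fst h0
  have e2 := congrArg Prod.snd h0
  simp only [spinStep, Prod.fst_zero, Prod.snd_zero] at e1 e2
  obtain ⟨u1, u2⟩ := hu
  set R : ℂ := (rad u : ℂ) + rad v
  set P : ℂ := (v.1 : ℂ) - u.1
  set Q : ℂ := v.2 - u.2
  have hQ : star Q = star v.2 - star u.2 := star_sub _ _
  have k1 : (R + P) * ψ.1 + star Q * ψ.2 = 0 := by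
    rw [hQ]; simp only [R, P]; linear_combination e1 + u1
  have k2 : Q * ψ.1 + (R - P) * ψ.2 = 0 := by
    simp only [R, P, Q]; linear_combination e2 + u2
  have hD : R ^ 2 - P ^ 2 - Q * star Q ≠ 0 := by
    have h2 : Q * star Q = ((‖Q‖ ^ 2 : ℝ) : ℂ) := by
      rw [← Complex.normSq_eq_norm_sq]; exact Complex.mul_conj _
    rw [h2]
    simp only [R, P]
    norm_cast
    linarith
  apply hψ
  ext
  · refine (mul_eq_zero.1 ?_).resolve_left hD
    linear_combination (R - P) * k1 - star Q * k2
  · refine (mul_eq_zero.1 ?_).resolve_left hD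
    linear_combination (R + P) * k2 - Q * k1

theorem spin_sum_ne_zero {p : ℝ} {ψ : ℂ × ℂ} (hp : p ≠ 0) (h : IsSpinor (p, 0) ψ) (hψ : ψ ≠ 0) :
    ψ.1 + ψ.2 ≠ 0 := by
  obtain ⟨h1, h2⟩ := h
  have hr : rad (p, 0) = |p| := by simp [rad, Real.sqrt_sq_eq_abs]
  rw [hr] at h1 h2
  simp only [star_zero, zero_mul, sub_zero, neg_zero, zero_add, mul_eq_zero] at h1 h2
  intro h0
  apply hψ
  rcases lt_or_gt_of_ne hp with hp | hp
  · have : ψ.1 = 0 := h1.resolve_left (by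
      rw [abs_of_neg hp]; norm_cast; linarith)
    ext
    · exact this
    · simpa [this] using h0
  · have : ψ.2 = 0 := h2.resolve_left (by
      rw [abs_of_pos hp]; norm_cast; linarith)
    ext
    · simpa [this] using h0
    · exact this

@[fun_prop]
theorem continuous_rad : Continuous rad := by unfold rad; fun_prop

/-- Discrete parallel transport along `v` with step `1 / N`, starting at `-1`. -/
def transport (v : ℝ → ℝ × ℂ) (N : ℕ) : ℕ → ℂ × ℂ
  | 0 => (1, 0)
  | j + 1 => spinStep (v ((j + 1) / N - 1)) (transport v N j)

theorem continuous_transport {Y : Type*} [TopologicalSpace Y] {F : Y → ℝ → ℝ × ℂ}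
    (hF : ∀ c, Continuous fun y => F y c) (N j : ℕ) :
    Continuous fun y => transport (F y) N j := by
  induction j with
  | zero => exact continuous_const
  | succ j ih =>
    have := hF ((j + 1) / N - 1)
    simp only [transport, spinStep]
    fun_prop

theorem transport_spec {v : ℝ → ℝ × ℂ} {N : ℕ} (h0 : v (-1) = (1, 0))
    (h : ∀ j < 2 * N, ((v ((j + 1) / N - 1)).1 - (v (j / N - 1)).1) ^ 2 +
      ‖(v ((j + 1) / N - 1)).2 - (v (j / N - 1)).2‖ ^ 2 <
        (rad (v (j / N - 1)) + rad (v ((j + 1) / N - 1))) ^ 2) (j : ℕ) (hj : j ≤ 2 * N) :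
    IsSpinor (v (j / N - 1)) (transport v N j) ∧ transport v N j ≠ 0 := by
  induction j with
  | zero =>
    simp [h0, IsSpinor, transport, rad]
  | succ j ih =>
    obtain ⟨h1, h2⟩ := ih (by omega)
    refine ⟨?_, spinStep_ne_zero h1 h2 (h j (by omega))⟩
    push_cast
    exact isSpinor_spinStep _ _

theorem exists_mesh {F : unitInterval × unitInterval → ℝ → ℝ × ℂ} (hF : Continuous ↿F)
    (hne : ∀ z c, |c| ≤ 1 → F z c ≠ 0) (h0 : ∀ z, F z (-1) = (1, 0)) (h1 : ∀ z, (F z 1).2 = 0) :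
    ∃ N₀ : ℕ, ∀ N : ℕ, N₀ ≤ N → ∀ z,
      (transport (F z) N (2 * N)).1 + (transport (F z) N (2 * N)).2 ≠ 0 := by
  let G : (unitInterval × unitInterval) × unitInterval → ℝ × ℂ := fun z => F z.1 (2 * z.2 - 1)
  have hG : Continuous G :=
    hF.comp (f := fun z : (unitInterval × unitInterval) × unitInterval =>
      (z.1, 2 * (z.2 : ℝ) - 1)) (by fun_prop)
  obtain ⟨z₀, -, hz₀⟩ := isCompact_univ.exists_isMinOn Set.univ_nonempty hG.norm.continuousOn
  have hδ : 0 < ‖G z₀‖ := norm_pos_iff.2 (hne _ _ (by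
    rw [abs_le]; constructor <;> linarith [z₀.2.2.1, z₀.2.2.2]))
  set δ := ‖G z₀‖
  have hmin : ∀ z, δ ≤ ‖G z‖ := fun z => hz₀ (Set.mem_univ z)
  obtain ⟨η, hη, hG'⟩ := Metric.uniformContinuous_iff.1
    (CompactSpace.uniformContinuous_of_continuous hG) (δ / 2) (by positivity)
  obtain ⟨N₀, hN₀⟩ := exists_nat_gt (1 / η)
  have hpos : (0 : ℝ) < N₀ := (by positivity : (0 : ℝ) < 1 / η).trans hN₀
  refine ⟨N₀, fun N hN z => ?_⟩
  have hN' : (N₀ : ℝ) ≤ N := by exact_mod_cast hN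
  have hNpos : (0 : ℝ) < N := hpos.trans_le hN'
  have hτ : ∀ j : ℕ, j ≤ 2 * N → (j / (2 * N) : ℝ) ∈ Set.Icc (0 : ℝ) 1 := fun j hj => by
    refine ⟨by positivity, (div_le_one (by positivity)).2 ?_⟩
    exact_mod_cast hj
  have hGF : ∀ j (hj : j ≤ 2 * N), G (z, ⟨_, hτ j hj⟩) = F z (j / N - 1) := fun j hj => by
    simp only [G]; congr 1; field_simp
  have key := transport_spec (v := F z) (N := N) (h0 z) (fun j hj => by
    have hu := hGF j hj.le
    have hv := hGF (j + 1) hj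
    have hd : dist (F z (j / N - 1)) (F z ((j + 1) / N - 1)) < δ / 2 := by
      push_cast at hv
      rw [← hu, ← hv]
      refine hG' ?_
      rw [Prod.dist_eq, dist_self, Subtype.dist_eq, Real.dist_eq, max_lt_iff]
      refine ⟨hη, ?_⟩
      have : ((j : ℝ) / (2 * N) - (j + 1) / (2 * N)) = -(1 / (2 * N)) := by ring
      rw [this, abs_neg, abs_of_pos (by positivity), div_lt_iff₀ (by positivity)]
      have h1 : 1 < N₀ * η := (div_lt_iff₀ hη).1 hN₀
      nlinarith
    have hr : ∀ w : ℝ × ℂ, ‖w‖ ≤ rad w := fun w => by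
      rw [Prod.norm_def]
      refine max_le ?_ ?_ <;> refine Real.le_sqrt_of_sq_le ?_
      · rw [Real.norm_eq_abs, sq_abs]; nlinarith [sq_nonneg ‖w.2‖]
      · nlinarith [sq_nonneg w.1]
    have m1 := (hmin (z, ⟨_, hτ j hj.le⟩)).trans (hr _)
    rw [hu] at m1
    have m2 := (hr (F z ((j + 1) / N - 1)))
    have m2' := norm_nonneg (F z ((j + 1) / N - 1))
    rw [dist_comm, dist_eq_norm, Prod.norm_def, max_lt_iff] at hd
    obtain ⟨d1, d2⟩ := hd
    simp only [Prod.fst_sub, Prod.snd_sub, Real.norm_eq_abs] at d1 d2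
    rw [← sq_abs ((F z _).1 - _)]
    have e1 := abs_nonneg ((F z ((j + 1) / N - 1)).1 - (F z (j / N - 1)).1)
    have e2 := norm_nonneg ((F z ((j + 1) / N - 1)).2 - (F z (j / N - 1)).2)
    generalize |(F z ((j + 1) / N - 1)).1 - (F z (j / N - 1)).1| = A at *
    generalize ‖(F z ((j + 1) / N - 1)).2 - (F z (j / N - 1)).2‖ = B at *
    have : δ ≤ rad (F z (j / N - 1)) + rad (F z ((j + 1) / N - 1)) := by linarith
    nlinarith) (2 * N) le_rfl
  have hend : ((2 * N : ℕ) : ℝ) / N - 1 = 1 := by push_cast; field_simp; norm_num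
  rw [hend] at key
  have hF1 : F z 1 = ((F z 1).1, 0) := Prod.ext rfl (h1 z)
  refine spin_sum_ne_zero (p := (F z 1).1) (fun h => ?_) (hF1 ▸ key.1) key.2
  refine hne z 1 (by simp) ?_
  rw [hF1, h]; rfl

/-- `b` is a nonvanishing loop with winding number `k`. -/
def HasWinding (b : unitInterval → ℂ) (k : ℤ) : Prop :=
  ∃ l : C(unitInterval, ℂ), (∀ t, Complex.exp (l t) = b t) ∧
    l 1 - l 0 = k * (2 * Real.pi * Complex.I)

theorem exists_log_unitSquare {B : unitInterval × unitInterval → ℂ} (hB : Continuous B)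
    (h0 : ∀ z, B z ≠ 0) :
    ∃ l : C(unitInterval × unitInterval, ℂ), ∀ z, Complex.exp (l z) = B z := by
  let g : C(unitInterval × unitInterval, {z : ℂ // z ≠ 0}) := ⟨fun t => ⟨B t, h0 t⟩, by fun_prop⟩
  have hg : g 0 = ⟨_, (Complex.log (B 0)).exp_ne_zero⟩ := by
    apply Subtype.ext; simp [g, Complex.exp_log (h0 0)]
  have : ContractibleSpace unitInterval :=
    (convex_Icc (0 : ℝ) 1).contractibleSpace ⟨0, by simp⟩
  have : LocallyPathConnectedSpace unitInterval := (convex_Icc (0 : ℝ) 1).locallyPathConnectedSpace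
  obtain ⟨l, ⟨-, hl⟩, -⟩ := Complex.isCoveringMap_exp.existsUnique_continuousMap_lifts g 0 _ hg.symm
  exact ⟨l, fun z => congrArg Subtype.val (congrFun hl z)⟩

theorem eq_of_exp_eq_one {Y : Type*} [TopologicalSpace Y] [PreconnectedSpace Y] {f : Y → ℂ}
    (hf : Continuous f) (h : ∀ y, Complex.exp (f y) = 1) (y z : Y) : f y = f z := by
  have hc : ∀ y, ∃ k : ℤ, f y = k * (2 * Real.pi * Complex.I) := fun y =>
    Complex.exp_eq_one_iff.1 (h y)
  choose k hk using hc
  have hpi : (2 * Real.pi * Complex.I : ℂ) ≠ 0 := Complex.two_pi_I_ne_zero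
  have hk' : Continuous fun y => (k y : ℝ) := by
    have : (fun y => (k y : ℝ)) = fun y => (f y / (2 * Real.pi * Complex.I)).re := by
      funext y
      rw [hk y, mul_div_assoc, div_self hpi]; simp
    rw [this]
    exact Complex.continuous_re.comp (hf.div_const _)
  have : Continuous k := (Int.isClosedEmbedding_coe_real.isEmbedding.continuous_iff).2 hk'
  rw [hk y, hk z, PreconnectedSpace.constant inferInstance this (x := y) (y := z)]

theorem HasWinding.unique {b : unitInterval → ℂ} {k k' : ℤ} (h : HasWinding b k)
    (h' : HasWinding b k') : k = k' := by
  obtain ⟨l, hl, hk⟩ := h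
  obtain ⟨l', hl', hk'⟩ := h'
  have := eq_of_exp_eq_one (f := fun t => l t - l' t) (by fun_prop) (fun t => by
    rw [Complex.exp_sub, hl, hl', div_self]
    rw [← hl]; exact Complex.exp_ne_zero _) 0 1
  have e : ((k : ℂ) - k') * (2 * Real.pi * Complex.I) = 0 := by
    replace this : l 0 - l' 0 = l 1 - l' 1 := this
    linear_combination hk' - hk - this
  have := (mul_eq_zero.1 e).resolve_right Complex.two_pi_I_ne_zero
  rw [sub_eq_zero] at this
  exact_mod_cast this

theorem hasWinding_turn (m : ℤ) {a : ℂ} (ha : a ≠ 0) :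
    HasWinding (fun t => turn m t * a) m := by
  refine ⟨⟨fun t => m * (2 * Real.pi * Complex.I) * t + Complex.log a, by fun_prop⟩,
    fun t => ?_, ?_⟩
  · simp only [ContinuousMap.coe_mk, Complex.exp_add, Complex.exp_log ha]; rfl
  · simp

theorem exists_hasWinding {B : unitInterval × unitInterval → ℂ} (hB : Continuous B)
    (h0 : ∀ z, B z ≠ 0) (hloop : ∀ s, B (s, 0) = B (s, 1)) :
    ∃ k, HasWinding (fun t => B (0, t)) k ∧ HasWinding (fun t => B (1, t)) k := by
  obtain ⟨l, hl⟩ := exists_log_unitSquare hB h0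
  have h1 : ∀ s, Complex.exp (l (s, 1) - l (s, 0)) = 1 := fun s => by
    rw [Complex.exp_sub, hl, hl, hloop, div_self (h0 _)]
  obtain ⟨k, hk⟩ := Complex.exp_eq_one_iff.1 (h1 0)
  have := eq_of_exp_eq_one (f := fun s => l (s, 1) - l (s, 0)) (by fun_prop) h1 0 1
  exact ⟨k, ⟨⟨fun t => l (0, t), by fun_prop⟩, fun t => hl _, hk⟩,
    ⟨⟨fun t => l (1, t), by fun_prop⟩, fun t => hl _, this.symm.trans hk⟩⟩

end

section

/-- The homogenization of `evP`. -/
def homP {n : ℕ} (c d : ℝ) (p : Fin n → ℝ) : ℝ := c ^ n + ∑ i, p i * (c ^ (i : ℕ) * d ^ (n - i))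

/-- The homogenization of `evQ`. -/
def homQ {n : ℕ} (c d : ℝ) (q : Fin n → ℂ) : ℂ :=
  ∑ i : Fin n, q i * ((c : ℂ) ^ (i : ℕ) * (d : ℂ) ^ (n - i))

@[fun_prop]
theorem Continuous.homP {Y : Type*} [TopologicalSpace Y] {n : ℕ} {c d : Y → ℝ} {p : Y → Fin n → ℝ}
    (hc : Continuous c) (hd : Continuous d) (hp : Continuous p) :
    Continuous fun y => homP (c y) (d y) (p y) := by
  unfold _root_.homP
  fun_prop

@[fun_prop]
theorem Continuous.homQ {Y : Type*} [TopologicalSpace Y] {n : ℕ} {c d : Y → ℝ} {q : Y → Fin n → ℂ}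
    (hc : Continuous c) (hd : Continuous d) (hq : Continuous q) :
    Continuous fun y => homQ (c y) (d y) (q y) := by
  unfold _root_.homQ
  fun_prop

theorem homP_eq {n : ℕ} (c : ℝ) {d : ℝ} (hd : d ≠ 0) (p : Fin n → ℝ) :
    homP c d p = d ^ n * evP (c / d) p := by
  rw [homP, evP, mul_add, Finset.mul_sum, div_pow, mul_div_cancel₀ _ (pow_ne_zero _ hd)]
  congr 1
  refine Finset.sum_congr rfl fun i _ => ?_
  rw [div_pow, pow_sub₀ _ hd i.2.le]
  field_simp

theorem homQ_eq {n : ℕ} (c : ℝ) {d : ℝ} (hd : d ≠ 0) (q : Fin n → ℂ) :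
    homQ c d q = (d : ℂ) ^ n * evQ (c / d) q := by
  have hd' : (d : ℂ) ≠ 0 := by exact_mod_cast hd
  rw [homQ, evQ_apply, Finset.mul_sum]
  refine Finset.sum_congr rfl fun i _ => ?_
  rw [pow_sub₀ _ hd' i.2.le]
  push_cast
  rw [div_pow]
  field_simp

theorem homP_zero {n : ℕ} (c : ℝ) (p : Fin n → ℝ) : homP c 0 p = c ^ n := by
  rw [homP, Finset.sum_eq_zero, add_zero]
  intro i _
  rw [zero_pow (by have := i.2; omega)]; ring

theorem homQ_zero {n : ℕ} (c : ℝ) (q : Fin n → ℂ) : homQ c 0 q = 0 := by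
  rw [homQ, Finset.sum_eq_zero]
  intro i _
  rw [Complex.ofReal_zero, zero_pow (by have := i.2; omega)]; ring

theorem homP_ne_zero {n : ℕ} {c d : ℝ} (hd : d = 0) (hc : c ≠ 0) (p : Fin n → ℝ) :
    homP c d p ≠ 0 := by
  rw [hd, homP_zero]; exact pow_ne_zero _ hc

/-- The arc from `-1` to `1` in `ℝ³ ∖ 0` attached to a pair of polynomials. -/
def arc {n : ℕ} (e : (Fin n → ℝ) × (Fin n → ℂ)) (c : ℝ) : ℝ × ℂ :=
  ((-1) ^ n * homP c (1 - |c|) e.1, homQ c (1 - |c|) e.2)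

theorem arc_ne_zero {n : ℕ} {e : (Fin n → ℝ) × (Fin n → ℂ)} (he : e ∈ coprimeLocus n) {c : ℝ}
    (hc : |c| ≤ 1) : arc e c ≠ 0 := by
  intro h
  have h1 : homP c (1 - |c|) e.1 = 0 := by simpa [arc] using congrArg Prod.fst h
  have h2 : homQ c (1 - |c|) e.2 = 0 := congrArg Prod.snd h
  have hd : 1 - |c| ≠ 0 := fun hd => homP_ne_zero hd (by
    rintro rfl; norm_num at hd) e.1 h1
  rw [homP_eq _ hd, mul_eq_zero] at h1
  rw [homQ_eq _ hd, mul_eq_zero] at h2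
  exact he _ (h1.resolve_left (pow_ne_zero _ hd))
    (h2.resolve_left (pow_ne_zero _ (by exact_mod_cast hd)))

theorem arc_neg_one {n : ℕ} (e : (Fin n → ℝ) × (Fin n → ℂ)) : arc e (-1) = (1, 0) := by
  simp [arc, homP_zero, homQ_zero, ← mul_pow]

theorem arc_one_snd {n : ℕ} (e : (Fin n → ℝ) × (Fin n → ℂ)) : (arc e 1).2 = 0 := by
  simp [arc, homQ_zero]

/-- A model arc, with the values left of `0` rotated by `e`. -/
def modelQ (e : ℂ) (c : ℝ) : ℂ := (1 - |c| : ℝ) * (e * (max (-c) 0 : ℝ) + (max c 0 : ℝ))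

theorem modelQ_of_nonpos (e : ℂ) {c : ℝ} (hc : c ≤ 0) : modelQ e c = e * modelQ 1 c := by
  simp only [modelQ, max_eq_left (neg_nonneg.2 hc), max_eq_right hc]; push_cast; ring

theorem modelQ_of_nonneg (e : ℂ) {c : ℝ} (hc : 0 ≤ c) : modelQ e c = modelQ 1 c := by
  simp only [modelQ, max_eq_right (neg_nonpos.2 hc), max_eq_left hc]; push_cast; ring

theorem transport_model_le {a : ℝ → ℝ} {e : ℂ} (he : ‖e‖ = 1) {N : ℕ} (j : ℕ) (hj : j ≤ N) :
    transport (fun c => (a c, modelQ e c)) N j =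
      ((transport (fun c => (a c, modelQ 1 c)) N j).1,
        e * (transport (fun c => (a c, modelQ 1 c)) N j).2) := by
  induction j with
  | zero => simp [transport]
  | succ j ih =>
    have hc : ((j : ℝ) + 1) / N - 1 ≤ 0 := by
      have h1 : (j : ℝ) + 1 ≤ N := by exact_mod_cast hj
      have : ((j : ℝ) + 1) / N ≤ 1 := div_le_one_of_le₀ h1 (by positivity)
      linarith
    have hee : star e * e = 1 := by
      have : star e * e = ((‖e‖ ^ 2 : ℝ) : ℂ) := by
        rw [← Complex.normSq_eq_norm_sq, mul_comm]; exact Complex.mul_conj _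
      rw [this, he]; simp
    simp only [transport, ih (by omega)]
    rw [modelQ_of_nonpos e hc]
    simp only [spinStep, rad, norm_mul, he, one_mul, star_mul']
    ext
    · linear_combination (star (modelQ 1 ((j + 1) / N - 1)) *
        (transport (fun c => (a c, modelQ 1 c)) N j).2) * hee
    · simp only; ring

theorem transport_model_ge {a : ℝ → ℝ} {e : ℂ} (he : ‖e‖ = 1) (ha : a 0 < 0) {N : ℕ} (hN : N ≠ 0)
    (j : ℕ) (hj : N ≤ j) :
    transport (fun c => (a c, modelQ e c)) N j =
      (e * (transport (fun c => (a c, modelQ 1 c)) N j).1,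
        e * (transport (fun c => (a c, modelQ 1 c)) N j).2) := by
  have hNpos : (0 : ℝ) < N := by exact_mod_cast Nat.pos_of_ne_zero hN
  induction j, hj using Nat.le_induction with
  | base =>
    rw [transport_model_le he N le_rfl]
    obtain ⟨k, rfl⟩ := Nat.exists_eq_succ_of_ne_zero hN
    have hc : ((k : ℝ) + 1) / (k.succ : ℕ) - 1 = 0 := by
      push_cast at hNpos ⊢; rw [div_self hNpos.ne', sub_self]
    have : (transport (fun c => (a c, modelQ 1 c)) k.succ k.succ).1 = 0 := by
      simp only [transport, hc, spinStep]
      have hm : modelQ 1 0 = 0 := by simp [modelQ]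
      rw [hm]
      simp [rad, Real.sqrt_sq_eq_abs, abs_of_neg ha]
    rw [this]; simp
  | succ j hj ih =>
    have hc : 0 ≤ ((j : ℝ) + 1) / N - 1 := by
      have h1 : (N : ℝ) ≤ j := by exact_mod_cast hj
      have : 1 ≤ ((j : ℝ) + 1) / N := (one_le_div hNpos).2 (by linarith)
      linarith
    simp only [transport, ih]
    rw [modelQ_of_nonneg e hc]
    simp only [spinStep]
    ext <;> simp only <;> ring

variable {n : ℕ} [NeZero n]

theorem mix_ne_zero {e : ℂ} (he : ‖e‖ = 1) {A B : ℝ} (h1 : A + B ≠ 0) (h2 : A - B ≠ 0) :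
    e * A + B ≠ 0 := by
  intro h
  have : ‖e * A‖ = ‖(B : ℂ)‖ := by rw [eq_neg_of_add_eq_zero_left h, norm_neg]
  rw [norm_mul, he, one_mul, Complex.norm_real, Complex.norm_real, Real.norm_eq_abs,
    Real.norm_eq_abs, abs_eq_abs] at this
  rcases this with h | h
  · exact h2 (by linarith)
  · exact h1 (by linarith)

/-- The deformation from the arc of `elemLoop` to the model arc. -/
def modelArc (n : ℕ) [NeZero n] (m : ℤ) (z : unitInterval × unitInterval) (c : ℝ) : ℝ × ℂ :=
  ((-1) ^ n * homP c (1 - |c|) (pstar n),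
    (1 - z.1 : ℝ) * homQ c (1 - |c|) (elemQ m (pstar n) 0 z.2) + (z.1 : ℝ) * modelQ (turn m z.2) c)

theorem modelArc_ne_zero (m : ℤ) (z : unitInterval × unitInterval) {c : ℝ} (hc : |c| ≤ 1) :
    modelArc n m z c ≠ 0 := by
  intro h
  have h1 : homP c (1 - |c|) (pstar n) = 0 := by
    simpa [modelArc] using congrArg Prod.fst h
  have h2 := congrArg Prod.snd h
  simp only [modelArc, Prod.snd_zero] at h2
  have hd : 1 - |c| ≠ 0 := fun hd => homP_ne_zero hd (by
    rintro rfl; norm_num at hd) _ h1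
  have hdpos : 0 < 1 - |c| := lt_of_le_of_ne (by linarith) hd.symm
  rw [homP_eq _ hd, mul_eq_zero] at h1
  replace h1 := h1.resolve_left (pow_ne_zero _ hd)
  have hc0 : c ≠ 0 := by
    rintro rfl
    rw [zero_div] at h1
    exact evP_zero_pstar_ne h1
  rw [homQ_eq _ hd, evQ_elemQ m h1, turnVal, sub_zero, modelQ] at h2
  have s0 := z.1.2.1
  have s1 := z.1.2.2
  generalize (z.1 : ℝ) = s at *
  set d := 1 - |c|
  have hdn : 0 < d ^ n := by positivity
  refine mix_ne_zero (norm_turn m z.2)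
    (A := (1 - s) * (d ^ n * (1 - c / d) / 2) + s * (d * max (-c) 0))
    (B := (1 - s) * (d ^ n * (1 + c / d) / 2) + s * (d * max c 0)) ?_ ?_ ?_
  · have : max (-c) 0 + max c 0 = |c| := by
      rcases le_total c 0 with h | h
      · simp [h, abs_of_nonpos]
      · simp [h, abs_of_nonneg]
    have e : (1 - s) * (d ^ n * (1 - c / d) / 2) + s * (d * max (-c) 0) +
      ((1 - s) * (d ^ n * (1 + c / d) / 2) + s * (d * max c 0)) =
        (1 - s) * d ^ n + s * (d * |c|) := by rw [← this]; ring
    rw [e]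
    have : 0 < d * |c| := by positivity
    rcases eq_or_lt_of_le s0 with h | h
    · rw [← h]; simpa using hdn.ne'
    · nlinarith
  · have : max (-c) 0 - max c 0 = -c := by
      rcases le_total c 0 with h | h
      · simp [h]
      · simp [h]
    have e : (1 - s) * (d ^ n * (1 - c / d) / 2) + s * (d * max (-c) 0) -
      ((1 - s) * (d ^ n * (1 + c / d) / 2) + s * (d * max c 0)) =
        -c * ((1 - s) * (d ^ n / d) + s * d) := by
      linear_combination (s * d) * this
    rw [e]
    have : 0 < d ^ n / d := by positivity
    refine mul_ne_zero (neg_ne_zero.2 hc0) ?_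
    rcases eq_or_lt_of_le s0 with h | h
    · rw [← h, sub_zero, one_mul, zero_mul, add_zero]; exact this.ne'
    · nlinarith
  · rw [← h2]
    push_cast
    ring

theorem continuous_modelArc (m : ℤ) : Continuous ↿(modelArc n m) := by
  unfold modelArc elemQ modelQ Function.HasUncurry.uncurry Function.hasUncurryInduction
    Function.hasUncurryBase
  simp only [id]
  fun_prop

theorem genClass_injective {m : ℤ} (h : genClass n m = .refl _) : m = 0 := by
  rw [genClass, ← Path.Homotopic.Quotient.mk_refl, Path.Homotopic.Quotient.eq] at h
  obtain ⟨H⟩ := h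
  let F₁ : unitInterval × unitInterval → ℝ → ℝ × ℂ := fun z => arc (H z).1
  have hF₁ : Continuous ↿F₁ := by
    have : Continuous fun z : (unitInterval × unitInterval) × ℝ => arc (H z.1).1 z.2 := by
      unfold arc
      fun_prop
    exact this
  obtain ⟨N₁, hN₁⟩ := exists_mesh hF₁ (fun z c => arc_ne_zero (H z).2)
    (fun z => arc_neg_one _) (fun z => arc_one_snd _)
  obtain ⟨N₂, hN₂⟩ := exists_mesh (continuous_modelArc (n := n) m)
    (fun z c => modelArc_ne_zero m z)
    (fun z => by simp [modelArc, homP_zero, homQ_zero, modelQ, ← mul_pow])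
    (fun z => by simp [modelArc, homQ_zero, modelQ])
  let N := max N₁ N₂ + 1
  have hN : N ≠ 0 := Nat.succ_ne_zero _
  replace hN₁ := hN₁ N (by omega)
  replace hN₂ := hN₂ N (by omega)
  have hB : ∀ {F : unitInterval × unitInterval → ℝ → ℝ × ℂ}, Continuous ↿F →
      Continuous fun z => (transport (F z) N (2 * N)).1 + (transport (F z) N (2 * N)).2 := by
    intro F hF
    have := continuous_transport (F := F) (fun c =>
      hF.comp (f := fun z : unitInterval × unitInterval => (z, c)) (by fun_prop)) N (2 * N)
    fun_prop
  obtain ⟨k₁, a₁, b₁⟩ := exists_hasWinding (hB hF₁) hN₁ (fun s => by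
    simp only [F₁, H.source, H.target])
  obtain ⟨k₂, a₂, b₂⟩ := exists_hasWinding (hB (continuous_modelArc (n := n) m)) hN₂ (fun s => by
    have : modelArc n m (s, 0) = modelArc n m (s, 1) := by
      funext c; simp [modelArc, elemQ]
    rw [this])
  have hk₁ : k₁ = 0 := by
    refine b₁.unique ?_
    have := hasWinding_turn 0 (hN₁ (1, 0))
    convert this using 2 with t
    simp [turn, F₁]
  have hk₂ : k₂ = k₁ := by
    refine a₂.unique ?_
    convert a₁ using 2 with t
    have : modelArc n m (0, t) = F₁ (0, t) := by
      have : H (0, t) = elemLoop m (pstar n) 0 evP_zero_pstar_ne t := H.apply_zero t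
      funext c
      simp only [modelArc, F₁, arc, this]
      simp [elemLoop]
    rw [this]
  rw [← hk₁, ← hk₂]
  refine HasWinding.unique ?_ b₂
  have := hasWinding_turn m (hN₂ (1, 0))
  convert this using 2 with t
  have ha : (-1) ^ n * homP 0 (1 - |0|) (pstar n) < 0 := by
    rw [abs_zero, sub_zero, homP_eq _ one_ne_zero, div_one, evP_zero_pstar]
    simp [← mul_pow]
  have key := transport_model_ge (a := fun c => (-1) ^ n * homP c (1 - |c|) (pstar n))
    (norm_turn m t) ha hN (2 * N) (by omega)
  have e : ∀ t, modelArc n m (1, t) = fun c =>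
      ((-1) ^ n * homP c (1 - |c|) (pstar n), modelQ (turn m t) c) := fun t => by
    funext c; simp [modelArc]
  rw [e, e, key, turn_at_zero]
  ring

end

section

variable {n : ℕ} [NeZero n]

/-- The homomorphism from `ℤ` to the fundamental group given by `genClass`. -/
def genHom (n : ℕ) [NeZero n] :
    Multiplicative ℤ →* FundamentalGroup (coprimeLocus n) (oneSlice (pstar n)) where
  toFun m := (genClass n m.toAdd : Path.Homotopic.Quotient _ _)
  map_one' := genClass_zero
  map_mul' a b := by
    refine Eq.trans ?_ (genClass_trans b.toAdd a.toAdd).symm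
    rw [add_comm]; rfl

theorem genHom_bijective : Function.Bijective (genHom n) := by
  refine ⟨(injective_iff_map_eq_one _).2 fun a h => ?_, fun q => ?_⟩
  · exact genClass_injective (n := n) h
  · obtain ⟨γ, rfl⟩ := Path.Homotopic.Quotient.mk_surjective q
    obtain ⟨m, hm⟩ := class_mem_range γ
    exact ⟨Multiplicative.ofAdd m, hm.symm⟩

theorem nonempty_fundamentalGroup_coprimeLocus (e : coprimeLocus n) :
    Nonempty (FundamentalGroup (coprimeLocus n) e ≃* Multiplicative ℤ) :=
  ⟨(FundamentalGroup.fundamentalGroupMulEquivOfPathConnected e (oneSlice (pstar n))).trans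
    (MulEquiv.ofBijective _ genHom_bijective).symm⟩

end

section

/-- The point of projective space spanned by a nonzero vector of Euclidean space. -/
def pt {m : ℕ} (u : EuclideanSpace ℝ (Fin (m + 1))) (hu : u ≠ 0) : RP m :=
  Projectivization.mk ℝ u.ofLp ((WithLp.ofLp_eq_zero 2).ne.2 hu)

/-- The Veronese embedding of projective space by projection matrices. -/
def veronese {m : ℕ} (P : RP m) : EuclideanSpace ℝ (Fin (m + 1) × Fin (m + 1)) :=
  P.lift (fun v : {v : Fin (m + 1) → ℝ // v ≠ 0} =>
    WithLp.toLp 2 fun ij => v.1 ij.1 * v.1 ij.2 / ∑ k, v.1 k ^ 2) (by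
    rintro ⟨a, ha⟩ ⟨b, hb⟩ t (rfl : a = t • b)
    have ht : t ≠ 0 := by rintro rfl; simp at ha
    congr 1
    funext ij
    simp only [Pi.smul_apply, smul_eq_mul, mul_pow, ← Finset.mul_sum]
    field_simp)

theorem veronese_pt {m : ℕ} (u : EuclideanSpace ℝ (Fin (m + 1))) (hu : u ≠ 0)
    (i j : Fin (m + 1)) : veronese (pt u hu) (i, j) = u i * u j / ‖u‖ ^ 2 := by
  rw [EuclideanSpace.real_norm_sq_eq]
  rfl

theorem exists_pt {m : ℕ} (P : RP m) : ∃ u hu, P = pt u hu := by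
  induction P using Projectivization.ind with
  | h v hv => exact ⟨WithLp.toLp 2 v, (WithLp.toLp_eq_zero 2).ne.2 hv, rfl⟩

/-- The squared cosine of the angle between two vectors. -/
def cosSq {m : ℕ} (u w : EuclideanSpace ℝ (Fin (m + 1))) : ℝ :=
  (inner ℝ u w) ^ 2 / (‖u‖ ^ 2 * ‖w‖ ^ 2)

theorem dist_veronese_sq {m : ℕ} {u w : EuclideanSpace ℝ (Fin (m + 1))} (hu : u ≠ 0) (hw : w ≠ 0) :
    dist (veronese (pt u hu)) (veronese (pt w hw)) ^ 2 = 2 * (1 - cosSq u w) := by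
  have h1 : ‖u‖ ^ 2 ≠ 0 := pow_ne_zero _ (norm_ne_zero_iff.2 hu)
  have h2 : ‖w‖ ^ 2 ≠ 0 := pow_ne_zero _ (norm_ne_zero_iff.2 hw)
  rw [dist_eq_norm, EuclideanSpace.real_norm_sq_eq, Fintype.sum_prod_type]
  simp only [PiLp.sub_apply, veronese_pt]
  have e1 : ∀ i j, (u i * u j / ‖u‖ ^ 2 - w i * w j / ‖w‖ ^ 2) ^ 2 =
      u i ^ 2 * u j ^ 2 / (‖u‖ ^ 2) ^ 2 - 2 * ((u i * w i) * (u j * w j)) / (‖u‖ ^ 2 * ‖w‖ ^ 2) +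
        w i ^ 2 * w j ^ 2 / (‖w‖ ^ 2) ^ 2 := fun i j => by
    field_simp
    ring
  have hin : inner ℝ u w = ∑ i, u i * w i := by
    rw [PiLp.inner_apply]
    exact Finset.sum_congr rfl fun i _ => by simp [mul_comm]
  simp only [e1, Finset.sum_add_distrib, Finset.sum_sub_distrib, ← Finset.sum_div,
    ← Finset.mul_sum, ← Finset.sum_mul, ← EuclideanSpace.real_norm_sq_eq, ← hin, cosSq]
  field_simp
  ring

theorem pt_eq_pt_iff {m : ℕ} {u w : EuclideanSpace ℝ (Fin (m + 1))} (hu : u ≠ 0) (hw : w ≠ 0) :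
    pt u hu = pt w hw ↔ ∃ a : ℝ, a • w = u := by
  rw [pt, pt, Projectivization.mk_eq_mk_iff']
  refine exists_congr fun a => ?_
  rw [← WithLp.ofLp_smul]
  exact (WithLp.ofLp_injective 2).eq_iff

theorem veronese_injective {m : ℕ} : Function.Injective (veronese (m := m)) := by
  intro P Q h
  obtain ⟨u, hu, rfl⟩ := exists_pt P
  obtain ⟨w, hw, rfl⟩ := exists_pt Q
  have hc : cosSq u w = 1 := by
    have := dist_veronese_sq hu hw
    rw [h, dist_self] at this; linarith
  have h1 := norm_ne_zero_iff.2 hu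
  have h2 := norm_ne_zero_iff.2 hw
  rw [cosSq, div_eq_one_iff_eq (by positivity), ← mul_pow] at hc
  have h3 : |inner ℝ u w / (‖u‖ * ‖w‖)| = 1 := by
    rw [abs_div, abs_of_pos (show 0 < ‖u‖ * ‖w‖ by positivity), div_eq_one_iff_eq (by positivity)]
    rw [← abs_of_pos (show 0 < ‖u‖ * ‖w‖ by positivity), ← sq_eq_sq_iff_abs_eq_abs]
    exact hc
  obtain ⟨-, r, -, hr⟩ := abs_real_inner_div_norm_mul_norm_eq_one_iff u w |>.1 h3
  refine ((pt_eq_pt_iff hw hu).2 ⟨r, hr.symm⟩).symm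

theorem isQuotientMap_mk (m : ℕ) : Topology.IsQuotientMap
    fun v : {v : Fin (m + 1) → ℝ // v ≠ 0} => (Projectivization.mk ℝ v.1 v.2 : RP m) :=
  isQuotientMap_quotient_mk'

theorem continuous_veronese {m : ℕ} : Continuous (veronese (m := m)) := by
  rw [(isQuotientMap_mk m).continuous_iff]
  have hc : Continuous fun v : {v : Fin (m + 1) → ℝ // v ≠ 0} =>
      fun ij : Fin (m + 1) × Fin (m + 1) => v.1 ij.1 * v.1 ij.2 / ∑ k, v.1 k ^ 2 := by
    have h1 : ∀ k, Continuous fun v : {v : Fin (m + 1) → ℝ // v ≠ 0} => v.1 k :=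
      fun k => (continuous_apply k).comp continuous_subtype_val
    refine continuous_pi fun ij => ((h1 _).mul (h1 _)).div
      (continuous_finsetSum _ fun k _ => (h1 k).pow 2) fun v h => v.2 ?_
    funext k
    rw [Finset.sum_eq_zero_iff_of_nonneg fun _ _ => sq_nonneg _] at h
    simpa using h k (Finset.mem_univ _)
  exact (PiLp.continuous_toLp 2 _).comp hc

instance compactSpace_RP (m : ℕ) : CompactSpace (RP m) := by
  let f : Metric.sphere (0 : Fin (m + 1) → ℝ) 1 → RP m := fun v =>
    Projectivization.mk ℝ v.1 (ne_zero_of_mem_unit_sphere v)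
  have hf : Continuous f := (isQuotientMap_mk m).continuous.comp
    (f := fun v : Metric.sphere (0 : Fin (m + 1) → ℝ) 1 =>
      (⟨v.1, ne_zero_of_mem_unit_sphere v⟩ : {v : Fin (m + 1) → ℝ // v ≠ 0})) (by fun_prop)
  refine Function.Surjective.compactSpace (f := f) hf ?_
  intro P
  induction P using Projectivization.ind with
  | h v hv =>
    refine ⟨⟨‖v‖⁻¹ • v, ?_⟩, ?_⟩
    · rw [mem_sphere_zero_iff_norm, norm_smul, norm_inv, norm_norm,
        inv_mul_cancel₀ (norm_ne_zero_iff.2 hv)]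
    · exact (Projectivization.mk_eq_mk_iff' ..).2 ⟨_, rfl⟩

theorem isClosedEmbedding_veronese (m : ℕ) : Topology.IsClosedEmbedding (veronese (m := m)) :=
  continuous_veronese.isClosedEmbedding veronese_injective

/-- The Veronese embedding on loops. -/
def loopVer {m : ℕ} (f : OmegaRP m) : C(OnePoint ℝ, EuclideanSpace ℝ (Fin (m + 1) × Fin (m + 1))) :=
  (⟨veronese, continuous_veronese⟩ : C(RP m, _)).comp f.1

theorem isEmbedding_loopVer (m : ℕ) : Topology.IsEmbedding (loopVer (m := m)) :=
  (ContinuousMap.isEmbedding_postcomp _ (isClosedEmbedding_veronese m).isEmbedding).comp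
    Topology.IsEmbedding.subtypeVal

@[simp]
theorem loopVer_apply {m : ℕ} (f : OmegaRP m) (z : OnePoint ℝ) :
    loopVer f z = veronese (f.1 z) := rfl

theorem mem_line_iff {m : ℕ} (P : RP m) (w : Fin (m + 1) → ℝ) :
    w ∈ P.submodule ↔ ∀ i, ∑ j, veronese P (i, j) * w j = w i := by
  obtain ⟨u, hu, rfl⟩ := exists_pt P
  have h1 : ‖u‖ ^ 2 ≠ 0 := pow_ne_zero _ (norm_ne_zero_iff.2 hu)
  simp only [veronese_pt]
  rw [pt, Projectivization.submodule_mk, Submodule.mem_span_singleton]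
  constructor
  · rintro ⟨a, rfl⟩ i
    simp only [Pi.smul_apply, smul_eq_mul]
    have : ∑ j, u i * u j / ‖u‖ ^ 2 * (a * u j) = a * u i / ‖u‖ ^ 2 * ∑ j, u j ^ 2 := by
      rw [Finset.mul_sum]
      exact Finset.sum_congr rfl fun j _ => by ring
    rw [this, ← EuclideanSpace.real_norm_sq_eq]
    field_simp
  · intro h
    refine ⟨(∑ j, u j * w j) / ‖u‖ ^ 2, funext fun i => ?_⟩
    rw [← h i, Pi.smul_apply, smul_eq_mul, Finset.sum_div, Finset.sum_mul]
    exact Finset.sum_congr rfl fun j _ => by ring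

end

section

open Filter Topology in
theorem eventually_evP_pos {n : ℕ} (p : Fin n → ℝ) : ∀ᶠ x in atTop, 0 < evP x p := by
  have h : Tendsto (fun x : ℝ => homP 1 x⁻¹ p) atTop (𝓝 (homP 1 0 p)) :=
    ((by fun_prop : Continuous fun y : ℝ => homP 1 y p).tendsto 0).comp tendsto_inv_atTop_zero
  rw [homP_zero, one_pow] at h
  filter_upwards [h.eventually (lt_mem_nhds one_pos), eventually_gt_atTop 0] with x hx hx0
  rw [homP_eq _ (inv_ne_zero hx0.ne'), one_div, inv_inv] at hx
  exact pos_of_mul_pos_right hx (by positivity)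

variable {n m : ℕ}

/-- Tuples of monic real polynomials of degree `n` without common real root. -/
def realLocus (n m : ℕ) : Set (Fin (m + 1) → Fin n → ℝ) := {a | ∀ x, ∃ i, evP x (a i) ≠ 0}

/-- The vector of values of a tuple of monic polynomials. -/
def evV (a : Fin (m + 1) → Fin n → ℝ) (x : ℝ) : EuclideanSpace ℝ (Fin (m + 1)) :=
  WithLp.toLp 2 fun i => evP x (a i)

@[simp]
theorem evV_apply (a : Fin (m + 1) → Fin n → ℝ) (x : ℝ) (i : Fin (m + 1)) :
    evV a x i = evP x (a i) := rfl

theorem mem_realLocus_iff {a : Fin (m + 1) → Fin n → ℝ} : a ∈ realLocus n m ↔ ∀ x, evV a x ≠ 0 := by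
  refine forall_congr' fun x => ?_
  rw [evV, Ne, WithLp.toLp_eq_zero, funext_iff, not_forall]
  rfl

/-- Homogeneous version of `evV` near infinity. -/
def homV (a : Fin (m + 1) → Fin n → ℝ) (y : ℝ) : EuclideanSpace ℝ (Fin (m + 1)) :=
  WithLp.toLp 2 fun i => homP 1 y (a i)

theorem evV_eq_homV (a : Fin (m + 1) → Fin n → ℝ) {x : ℝ} (hx : x ≠ 0) :
    evV a x = x ^ n • homV a x⁻¹ := by
  ext i
  simp only [evV, homV, PiLp.smul_apply, smul_eq_mul]
  rw [homP_eq _ (inv_ne_zero hx), one_div, inv_inv, inv_pow,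
    mul_inv_cancel_left₀ (pow_ne_zero _ hx)]

theorem homV_zero (a : Fin (m + 1) → Fin n → ℝ) : homV a 0 = WithLp.toLp 2 fun _ => 1 := by
  simp [homV, homP_zero]

theorem continuous_evV : Continuous fun z : (Fin (m + 1) → Fin n → ℝ) × ℝ => evV z.1 z.2 := by
  refine (PiLp.continuous_toLp 2 _).comp (continuous_pi fun i => ?_)
  fun_prop

theorem continuous_homV : Continuous fun z : (Fin (m + 1) → Fin n → ℝ) × ℝ => homV z.1 z.2 := by
  refine (PiLp.continuous_toLp 2 _).comp (continuous_pi fun i => ?_)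
  fun_prop

/-- The formula for `veronese` on vectors. -/
def verVec (u : EuclideanSpace ℝ (Fin (m + 1))) : EuclideanSpace ℝ (Fin (m + 1) × Fin (m + 1)) :=
  WithLp.toLp 2 fun ij => u ij.1 * u ij.2 / ‖u‖ ^ 2

theorem veronese_eq_verVec (u : EuclideanSpace ℝ (Fin (m + 1))) (hu : u ≠ 0) :
    veronese (pt u hu) = verVec u := by
  ext ij
  exact veronese_pt u hu _ _

theorem continuousAt_verVec {u : EuclideanSpace ℝ (Fin (m + 1))} (hu : u ≠ 0) :
    ContinuousAt verVec u := by
  refine (PiLp.continuous_toLp 2 _).continuousAt.comp (continuousAt_pi.2 fun ij => ?_)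
  exact ContinuousAt.div (by fun_prop) (by fun_prop) (pow_ne_zero _ (norm_ne_zero_iff.2 hu))

theorem verVec_smul {r : ℝ} (hr : r ≠ 0) (u : EuclideanSpace ℝ (Fin (m + 1))) :
    verVec (r • u) = verVec u := by
  ext ij
  simp only [verVec, PiLp.smul_apply, smul_eq_mul, norm_smul, mul_pow, Real.norm_eq_abs, sq_abs]
  field_simp

theorem ones_ne_zero : (WithLp.toLp 2 fun _ => 1 : EuclideanSpace ℝ (Fin (m + 1))) ≠ 0 := by
  rw [Ne, WithLp.toLp_eq_zero]
  exact fun h => one_ne_zero (congrFun h 0)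

/-- The point at `z` of the loop of a tuple of polynomials. -/
def ratPt (a : realLocus n m) (z : OnePoint ℝ) : RP m :=
  z.elim (basept m) fun x => pt (evV a.1 x) (mem_realLocus_iff.1 a.2 x)

open Filter Topology in
theorem continuous_ratPt : Continuous fun z : realLocus n m × OnePoint ℝ => ratPt z.1 z.2 := by
  rw [(isClosedEmbedding_veronese m).isInducing.continuous_iff, continuous_iff_continuousAt]
  rintro ⟨a, z⟩
  induction z using OnePoint.rec with
  | coe x =>
    have ho : IsOpenEmbedding (Prod.map id (↑) : realLocus n m × ℝ → realLocus n m × OnePoint ℝ) :=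
      IsOpenEmbedding.id.prodMap isOpenEmbedding_coe
    rw [show (a, (x : OnePoint ℝ)) = Prod.map id (↑) (a, x) from rfl, ← ho.continuousAt_iff]
    have : ((veronese ∘ fun z : realLocus n m × OnePoint ℝ => ratPt z.1 z.2) ∘ Prod.map id (↑)) =
        fun z : realLocus n m × ℝ => verVec (evV z.1.1 z.2) := by
      funext z
      exact veronese_eq_verVec _ (mem_realLocus_iff.1 z.1.2 z.2)
    rw [this]
    refine ContinuousAt.comp (g := verVec) (continuousAt_verVec (mem_realLocus_iff.1 a.2 x)) ?_
    exact (continuous_evV.comp (f := fun z : realLocus n m × ℝ => (z.1.1, z.2))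
      (by fun_prop)).continuousAt
  | infty =>
    let inv : OnePoint ℝ → ℝ := fun z => z.elim 0 fun x => x⁻¹
    have hinv : ContinuousAt inv ∞ := by
      rw [continuousAt_infty', coclosedCompact_eq_cocompact]
      rw [← Metric.cobounded_eq_cocompact]
      exact tendsto_inv₀_cobounded
    have heq : (veronese ∘ fun z : realLocus n m × OnePoint ℝ => ratPt z.1 z.2) =ᶠ[𝓝 (a, ∞)]
        fun z => verVec (homV z.1.1 (inv z.2)) := by
      have h0 : {z : realLocus n m × OnePoint ℝ | z.2 ≠ ((0 : ℝ) : OnePoint ℝ)} ∈ 𝓝 (a, ∞) :=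
        (isOpen_ne_fun continuous_snd continuous_const).mem_nhds (infty_ne_coe 0)
      filter_upwards [h0] with z hz
      obtain ⟨b, z⟩ := z
      induction z using OnePoint.rec with
      | coe x =>
        have hx : x ≠ 0 := by rintro rfl; exact hz rfl
        refine (veronese_eq_verVec _ (mem_realLocus_iff.1 b.2 x)).trans ?_
        rw [evV_eq_homV _ hx, verVec_smul (pow_ne_zero _ hx)]
        rfl
      | infty =>
        refine (veronese_eq_verVec _ ones_ne_zero).trans ?_
        change _ = verVec (homV b.1 0)
        rw [homV_zero]
    refine ContinuousAt.congr ?_ heq.symm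
    refine ContinuousAt.comp (g := verVec) (continuousAt_verVec ?_) ?_
    · change homV a.1 0 ≠ 0
      rw [homV_zero]; exact ones_ne_zero
    · refine ContinuousAt.comp (g := fun z : (Fin (m + 1) → Fin n → ℝ) × ℝ => homV z.1 z.2)
        (f := fun z : realLocus n m × OnePoint ℝ => (z.1.1, inv z.2))
        continuous_homV.continuousAt ?_
      exact (continuous_subtype_val.comp continuous_fst).continuousAt.prodMk
        (ContinuousAt.comp (g := inv) hinv continuous_snd.continuousAt)

/-- The loop of a tuple of monic polynomials. -/
def ratLoop : C(realLocus n m, OmegaRP m) where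
  toFun a := ⟨(⟨_, continuous_ratPt⟩ : C(realLocus n m × OnePoint ℝ, RP m)).curry a, rfl⟩
  continuous_toFun := by fun_prop

@[simp]
theorem ratLoop_coe (a : realLocus n m) (x : ℝ) :
    (ratLoop a).1 x = pt (evV a.1 x) (mem_realLocus_iff.1 a.2 x) := rfl

/-- The vectors of values of two tuples make an angle with cosine greater than `τ`. -/
def Near (τ : ℝ) (a b : Fin (m + 1) → Fin n → ℝ) : Prop :=
  ∀ x, τ * (‖evV a x‖ * ‖evV b x‖) < inner ℝ (evV a x) (evV b x)

theorem evV_combo {s t : ℝ} (h : s + t = 1) (a b : Fin (m + 1) → Fin n → ℝ) (x : ℝ) :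
    evV (s • a + t • b) x = s • evV a x + t • evV b x := by
  ext i
  simp only [evV, PiLp.add_apply, PiLp.smul_apply, smul_eq_mul, evP, Pi.add_apply, Pi.smul_apply,
    mul_add, add_mul, Finset.sum_add_distrib, Finset.mul_sum, mul_assoc]
  linear_combination -x ^ n * h

theorem convex_near {τ : ℝ} (hτ : 0 ≤ τ) (b : Fin (m + 1) → Fin n → ℝ) :
    Convex ℝ {a | Near τ a b} := by
  intro a ha a' ha' s t hs ht hst x
  have h1 := ha x
  have h2 := ha' x
  rw [evV_combo hst, inner_add_left, real_inner_smul_left, real_inner_smul_left]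
  have h3 := norm_add_le (s • evV a x) (t • evV a' x)
  rw [norm_smul, norm_smul, Real.norm_of_nonneg hs, Real.norm_of_nonneg ht] at h3
  have h4 : τ * (‖s • evV a x + t • evV a' x‖ * ‖evV b x‖) ≤
      s * (τ * (‖evV a x‖ * ‖evV b x‖)) + t * (τ * (‖evV a' x‖ * ‖evV b x‖)) := by
    have := mul_le_mul_of_nonneg_left (mul_le_mul_of_nonneg_right h3 (norm_nonneg (evV b x))) hτ
    linarith
  refine h4.trans_lt ?_
  rcases hs.eq_or_lt with rfl | hs
  · rw [zero_add] at hst; subst hst; simpa using h2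
  · nlinarith

theorem Near.mem_realLocus {τ : ℝ} {a b : Fin (m + 1) → Fin n → ℝ} (h : Near τ a b) :
    a ∈ realLocus n m := by
  refine mem_realLocus_iff.2 fun x h0 => ?_
  have := h x
  simp [h0] at this

theorem near_refl {τ : ℝ} (hτ : τ < 1) (a : realLocus n m) : Near τ a.1 a.1 := fun x => by
  have := norm_pos_iff.2 (mem_realLocus_iff.1 a.2 x)
  rw [real_inner_self_eq_norm_sq]
  nlinarith [mul_pos this this]

theorem near_of_dist_lt {τ : ℝ} {a b : realLocus n m} (hτ : 0 ≤ τ)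
    (h : dist (loopVer (ratLoop a)) (loopVer (ratLoop b)) ^ 2 < 2 * (1 - τ ^ 2)) :
    Near τ a.1 b.1 := by
  have hpos : ∀ x, 0 < ‖evV a.1 x‖ * ‖evV b.1 x‖ := fun x =>
    mul_pos (norm_pos_iff.2 (mem_realLocus_iff.1 a.2 x))
      (norm_pos_iff.2 (mem_realLocus_iff.1 b.2 x))
  have habs : ∀ x, τ * (‖evV a.1 x‖ * ‖evV b.1 x‖) <
      |inner ℝ (evV a.1 x) (evV b.1 x)| := fun x => by
    have h1 := ContinuousMap.dist_apply_le_dist (f := loopVer (ratLoop a))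
      (g := loopVer (ratLoop b)) (x : OnePoint ℝ)
    have h2 := dist_veronese_sq (mem_realLocus_iff.1 a.2 x) (mem_realLocus_iff.1 b.2 x)
    simp only [loopVer_apply, ratLoop_coe] at h1
    have h3 := pow_le_pow_left₀ dist_nonneg h1 2
    have h4 : τ ^ 2 < cosSq (evV a.1 x) (evV b.1 x) := by linarith
    rw [cosSq, ← mul_pow, lt_div_iff₀ (pow_pos (hpos x) 2), ← mul_pow, ← sq_abs (inner ℝ _ _)] at h4
    exact lt_of_pow_lt_pow_left₀ 2 (abs_nonneg _) h4
  have hc : Continuous fun x => inner ℝ (evV a.1 x) (evV b.1 x) :=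
    (continuous_evV.comp (f := fun x : ℝ => (a.1, x)) (by fun_prop)).inner
      (continuous_evV.comp (f := fun x : ℝ => (b.1, x)) (by fun_prop))
  obtain ⟨y, hy⟩ := ((Filter.eventually_all.2 fun i => eventually_evP_pos (a.1 i)).and
    (Filter.eventually_all.2 fun i => eventually_evP_pos (b.1 i))).exists
  have hy' : 0 < inner ℝ (evV a.1 y) (evV b.1 y) := by
    rw [PiLp.inner_apply]
    refine Finset.sum_pos (fun i _ => ?_) Finset.univ_nonempty
    simpa using mul_pos (hy.2 i) (hy.1 i)
  intro x
  refine (habs x).trans_eq (abs_of_nonneg ?_)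
  by_contra hneg
  obtain ⟨z, hz⟩ := mem_range_of_exists_le_of_exists_ge hc ⟨x, (not_le.1 hneg).le⟩ ⟨y, hy'.le⟩
  have := habs z
  simp only at hz
  rw [hz, abs_zero] at this
  exact absurd this (not_lt.2 (mul_nonneg hτ (hpos z).le))

theorem dist_le_of_near {τ : ℝ} {a b : realLocus n m} (hτ : 0 ≤ τ) (h : Near τ a.1 b.1) :
    dist (loopVer (ratLoop a)) (loopVer (ratLoop b)) ≤ √(2 * (1 - τ ^ 2)) := by
  rw [ContinuousMap.dist_le (Real.sqrt_nonneg _)]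
  intro z
  induction z using OnePoint.rec with
  | infty =>
    simp only [loopVer_apply, (ratLoop _).2, dist_self]
    exact Real.sqrt_nonneg _
  | coe x =>
    refine Real.le_sqrt_of_sq_le ?_
    simp only [loopVer_apply, ratLoop_coe]
    rw [dist_veronese_sq]
    have hp : 0 < ‖evV a.1 x‖ * ‖evV b.1 x‖ :=
      mul_pos (norm_pos_iff.2 (mem_realLocus_iff.1 a.2 x))
        (norm_pos_iff.2 (mem_realLocus_iff.1 b.2 x))
    have : τ ^ 2 ≤ cosSq (evV a.1 x) (evV b.1 x) := by
      rw [cosSq, ← mul_pow, le_div_iff₀ (pow_pos hp 2), ← mul_pow]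
      exact pow_le_pow_left₀ (by positivity) (h x).le 2
    linarith

end

section

variable {n m : ℕ}

theorem aeval_polyP (p : Fin n → ℝ) (z : ℂ) :
    Polynomial.aeval z (polyP p) = z ^ n + ∑ i, (p i : ℂ) * z ^ (i : ℕ) := by
  simp [polyP]

/-- Tuples of monic real polynomials of degree `n` without common complex root. -/
def complexLocus (n m : ℕ) : Set (Fin (m + 1) → Fin n → ℝ) :=
  {a | ∀ z : ℂ, ∃ i, Polynomial.aeval z (polyP (a i)) ≠ 0}

theorem complexLocus_subset : complexLocus n m ⊆ realLocus n m := by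
  intro a ha x
  obtain ⟨i, hi⟩ := ha x
  refine ⟨i, fun h => hi ?_⟩
  have : Polynomial.aeval ((x : ℝ) : ℂ) (polyP (a i)) = ((polyP (a i)).eval x : ℝ) :=
    Polynomial.aeval_algebraMap_apply_eq_algebraMap_eval x (polyP (a i))
  rw [this, eval_polyP, h, Complex.ofReal_zero]

theorem ratLoop_mem_RRat (a : realLocus n m) (ha : a.1 ∈ complexLocus n m) :
    ratLoop a ∈ RRat n m := by
  refine ⟨fun i => polyP (a.1 i), fun i => polyP_monic _, fun i => natDegree_polyP _, ha,
    fun x => ?_⟩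
  simp only [eval_polyP]
  exact ⟨(WithLp.ofLp_eq_zero 2).ne.2 (mem_realLocus_iff.1 a.2 x), rfl⟩

open Filter Topology in
theorem mem_closure_complexLocus [NeZero n] [NeZero m] (a : Fin (m + 1) → Fin n → ℝ) :
    a ∈ closure (complexLocus n m) := by
  let δ : Fin (m + 1) → Fin n → ℝ := Pi.single (Fin.last m) (Pi.single 0 1)
  have hlast : (0 : Fin (m + 1)) ≠ Fin.last m := (Fin.last_pos' ).ne
  let S : Set ℝ := Set.image (fun z => (-Polynomial.aeval z (polyP (a (Fin.last m)))).re)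
    {z : ℂ | Polynomial.aeval z (polyP (a 0)) = 0}
  have hS : S.Finite := by
    refine Set.Finite.image _ ?_
    refine ((polyP (a 0)).aroots ℂ).toFinset.finite_toSet.subset fun z hz => ?_
    simp only [Finset.mem_coe, Multiset.mem_toFinset]
    exact (Polynomial.mem_aroots).2 ⟨(polyP_monic _).ne_zero, hz⟩
  have hgood : ∀ ε ∉ S, a + ε • δ ∈ complexLocus n m := by
    intro ε hε z
    by_contra! h
    have h0 := h 0
    have h1 := h (Fin.last m)
    rw [Pi.add_apply, Pi.smul_apply, show δ 0 = 0 from Pi.single_eq_of_ne hlast _, smul_zero,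
      add_zero] at h0
    rw [Pi.add_apply, Pi.smul_apply, show δ (Fin.last m) = Pi.single 0 1 from Pi.single_eq_same _ _,
      aeval_polyP] at h1
    simp only [Pi.add_apply, Pi.smul_apply, smul_eq_mul, Complex.ofReal_add, add_mul,
      Finset.sum_add_distrib] at h1
    rw [← add_assoc, ← aeval_polyP, Finset.sum_eq_single (0 : Fin n) (by
      intro b _ hb; simp [Pi.single_eq_of_ne hb]) (by simp)] at h1
    simp only [Pi.single_eq_same, mul_one, Fin.val_zero, pow_zero] at h1
    exact hε ⟨z, h0, by simp [eq_neg_of_add_eq_zero_left h1]⟩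
  have hc : Tendsto (fun ε : ℝ => a + ε • δ) (𝓝[≠] 0) (𝓝 a) := by
    have : Continuous fun ε : ℝ => a + ε • δ := by fun_prop
    have := this.tendsto 0
    rw [zero_smul, add_zero] at this
    exact this.mono_left nhdsWithin_le_nhds
  refine mem_closure_of_tendsto hc ?_
  have hcl : IsClosed (S \ {0}) := (hS.subset Set.sdiff_subset).isClosed
  have : (S \ {0})ᶜ ∈ 𝓝 (0 : ℝ) := hcl.isOpen_compl.mem_nhds (by simp)
  filter_upwards [nhdsWithin_le_nhds this, self_mem_nhdsWithin] with ε h1 h2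
  exact hgood ε fun h => h1 ⟨h, h2⟩

theorem ratLoop_mem_ratSet [NeZero n] [NeZero m] (a : realLocus n m) : ratLoop a ∈ ratSet n m := by
  have h1 : a ∈ closure ((↑) ⁻¹' complexLocus n m : Set (realLocus n m)) := by
    rw [closure_subtype, Subtype.image_preimage_coe, Set.inter_eq_right.2 complexLocus_subset]
    exact mem_closure_complexLocus a.1
  have h2 := image_closure_subset_closure_image ratLoop.continuous ⟨a, h1, rfl⟩
  refine closure_mono ?_ h2
  rintro _ ⟨b, hb, rfl⟩
  exact ratLoop_mem_RRat b hb

theorem mem_line_pt {u : EuclideanSpace ℝ (Fin (m + 1))} (hu : u ≠ 0) (P : RP m) :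
    u.ofLp ∈ P.submodule ↔ P = pt u hu := by
  obtain ⟨w, hw, rfl⟩ := exists_pt P
  rw [eq_comm, pt_eq_pt_iff, pt, Projectivization.submodule_mk, Submodule.mem_span_singleton]
  refine exists_congr fun a => ?_
  rw [← WithLp.ofLp_smul]
  exact (WithLp.ofLp_injective 2).eq_iff

theorem continuous_veronese_apply (ij : Fin (m + 1) × Fin (m + 1)) :
    Continuous fun P : RP m => veronese P ij :=
  ((continuous_apply ij).comp (PiLp.continuous_ofLp 2 _)).comp continuous_veronese

open Polynomial in
theorem exists_polynomial_of_mem_ratSet {f : OmegaRP m} (hf : f ∈ ratSet n m) :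
    ∃ Q : Fin (m + 1) → ℝ[X], Q ≠ 0 ∧ (∀ i, (Q i).natDegree ≤ n) ∧
      ∀ x : ℝ, (fun i => (Q i).eval x) ∈ (f.1 x).submodule := by
  let S := Metric.sphere (0 : Fin (m + 1) → Fin (n + 1) → ℝ) 1
  let Z : Set (S × OmegaRP m) := {z | ∀ (x : ℝ) (i : Fin (m + 1)),
    ∑ j, veronese (z.2.1 x) (i, j) * ∑ k, z.1.1 j k * x ^ (k : ℕ) = ∑ k, z.1.1 i k * x ^ (k : ℕ)}
  have hZ : IsClosed Z := by
    have hb : ∀ j k, Continuous fun z : S × OmegaRP m => z.1.1 j k := fun j k =>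
      (continuous_apply k).comp ((continuous_apply j).comp
        (continuous_subtype_val.comp continuous_fst))
    have hs : ∀ j (x : ℝ), Continuous fun z : S × OmegaRP m => ∑ k, z.1.1 j k * x ^ (k : ℕ) :=
      fun j x => continuous_finsetSum _ fun k _ => (hb j k).mul continuous_const
    have hv : ∀ (x : ℝ) ij, Continuous fun z : S × OmegaRP m => veronese (z.2.1 x) ij := fun x ij =>
      (continuous_veronese_apply ij).comp ((continuous_eval_const _).comp
        (continuous_subtype_val.comp continuous_snd))
    simp only [Z, Set.ofPred_forall]
    exact isClosed_iInter fun x => isClosed_iInter fun i => isClosed_eq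
      (continuous_finsetSum _ fun j _ => (hv x _).mul (hs j x)) (hs i x)
  have hcl : IsClosed (Set.image Prod.snd Z) := isClosedMap_snd_of_compactSpace _ hZ
  have hsub : RRat n m ⊆ Set.image Prod.snd Z := by
    rintro g ⟨p, hm, hd, -, hg⟩
    let b : Fin (m + 1) → Fin (n + 1) → ℝ := fun i k => (p i).coeff k
    have hb : b ≠ 0 := fun h => by
      have h1 : (p 0).coeff n = 1 := by rw [← hd 0]; exact hm 0
      have h2 : (p 0).coeff n = 0 := congrFun (congrFun h 0) (Fin.last n)
      rw [h1] at h2; exact one_ne_zero h2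
    have he : ∀ i x, ∑ k, b i k * x ^ (k : ℕ) = (p i).eval x := fun i x => by
      rw [eval_eq_sum_range, hd, Finset.sum_range]
    refine ⟨(⟨‖b‖⁻¹ • b, ?_⟩, g), ?_, rfl⟩
    · rw [mem_sphere_zero_iff_norm, norm_smul, norm_inv, norm_norm,
        inv_mul_cancel₀ (norm_ne_zero_iff.2 hb)]
    · intro x i
      simp only [Pi.smul_apply, smul_eq_mul, mul_assoc, ← Finset.mul_sum, he]
      obtain ⟨hx, hx'⟩ := hg x
      have : (fun i => (p i).eval x) ∈ (g.1 x).submodule := by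
        rw [hx', Projectivization.submodule_mk]; exact Submodule.mem_span_singleton_self _
      rw [← (mem_line_iff _ _).1 this i, Finset.mul_sum]
      exact Finset.sum_congr rfl fun j _ => by ring
  obtain ⟨⟨⟨b, hb⟩, g⟩, hz, rfl⟩ := closure_minimal hsub hcl hf
  have hb0 : b ≠ 0 := ne_zero_of_mem_unit_sphere ⟨b, hb⟩
  refine ⟨fun i => ∑ k, C (b i k) * X ^ (k : ℕ), fun h => hb0 ?_, fun i => ?_, fun x => ?_⟩
  · funext i k
    have := congrArg (fun r => coeff r (k : ℕ)) (congrFun h i)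
    simpa [finsetSum_coeff, coeff_C_mul, coeff_X_pow, Fin.val_inj] using this
  · refine natDegree_sum_le_of_forall_le _ _ fun k _ => ?_
    exact (natDegree_C_mul_X_pow_le _ _).trans (Nat.lt_succ_iff.1 k.2)
  · rw [mem_line_iff]
    intro i
    simpa [eval_finsetSum] using hz x i

end

section

variable {n m : ℕ}

open Filter Topology in
theorem tendsto_veronese_atTop (f : OmegaRP m) (ij : Fin (m + 1) × Fin (m + 1)) :
    Tendsto (fun x : ℝ => veronese (f.1 x) ij) atTop (𝓝 (veronese (basept m) ij)) := by
  have hinf : veronese (basept m) ij = veronese (f.1 ∞) ij := by rw [f.2]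
  rw [hinf]
  have h1 := (((continuous_veronese_apply ij).comp f.1.continuous).tendsto ∞)
  have h2 := continuousAt_infty'.1 h1
  rw [coclosedCompact_eq_cocompact] at h2
  exact h2.mono_left atTop_le_cocompact

open Polynomial Filter Topology in
theorem exists_rootFree_of_mem_ratSet {f : OmegaRP m} (hf : f ∈ ratSet n m) :
    ∃ k ≤ n, ∃ R : Fin (m + 1) → ℝ[X], (∀ i, (R i).Monic ∧ (R i).natDegree = k) ∧
      ∀ x : ℝ, (fun i => (R i).eval x) ≠ 0 ∧ (fun i => (R i).eval x) ∈ (f.1 x).submodule := by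
  classical
  have hex : ∃ k, ∃ Q : Fin (m + 1) → ℝ[X], Q ≠ 0 ∧ (∀ i, (Q i).natDegree ≤ k) ∧
      ∀ x : ℝ, (fun i => (Q i).eval x) ∈ (f.1 x).submodule :=
    ⟨n, exists_polynomial_of_mem_ratSet hf⟩
  obtain ⟨Q, hQ0, hQd, hQ⟩ := Nat.find_spec hex
  have hmin := fun j => Nat.find_min hex (m := j)
  have hkn : Nat.find hex ≤ n := Nat.find_min' hex (exists_polynomial_of_mem_ratSet hf)
  generalize Nat.find hex = k at *
  have hroot : ∀ x, (fun i => (Q i).eval x) ≠ 0 := by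
    intro r hr
    have hr' : ∀ i, (X - C r) * (Q i /ₘ (X - C r)) = Q i := fun i =>
      mul_divByMonic_eq_iff_isRoot.2 (congrFun hr i)
    rcases Nat.eq_zero_or_pos k with rfl | hk
    · refine hQ0 (funext fun i => ?_)
      have h1 := eq_C_of_natDegree_le_zero (hQd i)
      have h2 : (Q i).eval r = 0 := congrFun hr i
      rw [h1, eval_C] at h2
      rw [h1, h2, C_0]; rfl
    · refine hmin (k - 1) (by omega) ⟨fun i => Q i /ₘ (X - C r), fun h => hQ0 (funext fun i => ?_),
        fun i => ?_, fun x => ?_⟩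
      · have h1 : Q i /ₘ (X - C r) = 0 := congrFun h i
        rw [← hr' i, h1, mul_zero]; rfl
      · rw [natDegree_divByMonic _ (monic_X_sub_C r), natDegree_X_sub_C]
        exact Nat.sub_le_sub_right (hQd i) 1
      · have hclosed : IsClosed {x : ℝ | (fun i => (Q i /ₘ (X - C r)).eval x) ∈
            (f.1 x).submodule} := by
          simp only [mem_line_iff, Set.ofPred_forall]
          have hv : ∀ ij, Continuous fun x : ℝ => veronese (f.1 x) ij := fun ij =>
            (continuous_veronese_apply ij).comp (f.1.continuous.comp continuous_coe)
          exact isClosed_iInter fun i => isClosed_eq (continuous_finsetSum _ fun j _ =>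
            (hv _).mul (Polynomial.continuous _)) (Polynomial.continuous _)
        have hsub : ({r}ᶜ : Set ℝ) ⊆ {x : ℝ | (fun i => (Q i /ₘ (X - C r)).eval x) ∈
            (f.1 x).submodule} := by
          intro y hy
          have hy' : y - r ≠ 0 := sub_ne_zero.2 hy
          have h1 := (f.1 y).submodule.smul_mem (y - r)⁻¹ (hQ y)
          have h2 : (y - r)⁻¹ • (fun i => (Q i).eval y) =
              fun i => (Q i /ₘ (X - C r)).eval y := by
            funext i
            rw [Pi.smul_apply, smul_eq_mul, ← hr' i, eval_mul, eval_sub, eval_X, eval_C,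
              inv_mul_cancel_left₀ hy', hr']
          rw [h2] at h1
          exact h1
        exact closure_minimal hsub hclosed ((dense_compl_singleton r).closure_eq ▸ Set.mem_univ x)
  have hlead : (fun i => (Q i).coeff k) ≠ 0 := by
    intro h
    have hc : ∀ i, (Q i).coeff k = 0 := congrFun h
    rcases Nat.eq_zero_or_pos k with rfl | hk
    · refine hQ0 (funext fun i => ?_)
      rw [eq_C_of_natDegree_le_zero (hQd i), hc, C_0]; rfl
    · refine hmin (k - 1) (by omega) ⟨Q, hQ0, fun i => ?_, hQ⟩
      refine natDegree_le_iff_coeff_eq_zero.2 fun N hN => ?_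
      rcases (show k ≤ N by omega).eq_or_lt with rfl | hN'
      · exact hc i
      · exact coeff_eq_zero_of_natDegree_lt ((hQd i).trans_lt hN')
  have hline : (fun i => (Q i).coeff k) ∈ (basept m).submodule := by
    have hrefl : ∀ i, Tendsto (fun x : ℝ => (reflect k (Q i)).eval x⁻¹) atTop
        (𝓝 ((Q i).coeff k)) := fun i => by
      have := ((reflect k (Q i)).continuous.tendsto 0).comp tendsto_inv_atTop_zero
      rwa [← coeff_zero_eq_eval_zero, coeff_reflect, revAt_le (Nat.zero_le k), Nat.sub_zero] at this
    rw [mem_line_iff]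
    intro i
    refine tendsto_nhds_unique_of_eventuallyEq (tendsto_finsetSum _ fun j _ =>
      (tendsto_veronese_atTop f (i, j)).mul (hrefl j)) (hrefl i) ?_
    filter_upwards [eventually_gt_atTop 0] with x hx
    have he : ∀ j, (reflect k (Q j)).eval x⁻¹ = (x ^ k)⁻¹ * (Q j).eval x := fun j => by
      let := invertibleOfNonzero hx.ne'
      have := eval₂_reflect_mul_pow (RingHom.id ℝ) x k (Q j) (hQd j)
      rw [eval, eval, ← this, invOf_eq_inv]
      field_simp
    simp only [he]
    rw [← (mem_line_iff _ _).1 (hQ x) i, Finset.mul_sum]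
    exact Finset.sum_congr rfl fun j _ => by ring
  rw [basept, Projectivization.submodule_mk, Submodule.mem_span_singleton] at hline
  obtain ⟨r, hr⟩ := hline
  have hr0 : r ≠ 0 := by rintro rfl; exact hlead (by rw [← hr, zero_smul])
  have hr' : ∀ i, (Q i).coeff k = r := fun i => by
    rw [← congrFun hr i]; simp
  have hmonic : ∀ i, (C r⁻¹ * Q i).coeff k = 1 := fun i => by
    rw [coeff_C_mul, hr', inv_mul_cancel₀ hr0]
  have hdeg : ∀ i, (C r⁻¹ * Q i).natDegree ≤ k := fun i => (natDegree_C_mul_le _ _).trans (hQd i)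
  have heval : ∀ x, (fun i => (C r⁻¹ * Q i).eval x) = r⁻¹ • fun i => (Q i).eval x := fun x => by
    funext i; simp
  refine ⟨k, hkn, fun i => C r⁻¹ * Q i, fun i => ⟨monic_of_natDegree_le_of_coeff_eq_one k (hdeg i)
    (hmonic i), le_antisymm (hdeg i) (le_natDegree_of_ne_zero (by rw [hmonic]; exact one_ne_zero))⟩,
    fun x => ?_⟩
  rw [heval]
  exact ⟨smul_ne_zero (inv_ne_zero hr0) (hroot x), (f.1 x).submodule.smul_mem _ (hQ x)⟩

open Polynomial Filter in
theorem exists_isRoot_of_odd {W : ℝ[X]} (hodd : Odd W.natDegree) : ∃ x, W.IsRoot x := by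
  wlog h0 : 0 ≤ W.leadingCoeff generalizing W
  · obtain ⟨x, hx⟩ := this (W := -W) (by rwa [natDegree_neg])
      (by rw [leadingCoeff_neg]; exact (neg_pos.2 (not_le.1 h0)).le)
    exact ⟨x, by simpa using hx⟩
  have hd : 0 < W.degree := natDegree_pos_iff_degree_pos.1 hodd.pos
  have hneg : (-W.comp (-X)).leadingCoeff = W.leadingCoeff := by
    rw [leadingCoeff_neg, leadingCoeff_comp (by simp)]
    simp [hodd.neg_one_pow]
  have h1 := tendsto_atTop_of_leadingCoeff_nonneg W hd h0
  have h2 := tendsto_atTop_of_leadingCoeff_nonneg (-W.comp (-X))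
    (natDegree_pos_iff_degree_pos.1 (by rw [natDegree_neg, natDegree_comp]; simpa using hodd.pos))
    (hneg ▸ h0)
  obtain ⟨y, hy⟩ := (h1.eventually_ge_atTop 0).exists
  obtain ⟨z, hz⟩ := (h2.eventually_ge_atTop 0).exists
  refine mem_range_of_exists_le_of_exists_ge W.continuous ⟨-z, ?_⟩ ⟨y, hy⟩
  simpa using hz

open Polynomial in
theorem even_natDegree_of_eval_ne_zero {W : ℝ[X]} (h : ∀ x, W.eval x ≠ 0) : Even W.natDegree := by
  by_contra hodd
  rw [Nat.not_even_iff_odd] at hodd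
  obtain ⟨x, hx⟩ := exists_isRoot_of_odd hodd
  exact h x hx

open Polynomial in
theorem even_add_of_mem_ratSet {f : OmegaRP m} (hf : f ∈ ratSet n m) {k : ℕ}
    {R : Fin (m + 1) → ℝ[X]} (hR : ∀ i, (R i).Monic ∧ (R i).natDegree = k)
    (hx : ∀ x : ℝ, (fun i => (R i).eval x) ≠ 0 ∧ (fun i => (R i).eval x) ∈ (f.1 x).submodule) :
    Even (k + n) := by
  have hopen : IsOpen {g : OmegaRP m | dist (loopVer f) (loopVer g) < 1} :=
    isOpen_lt (continuous_const.dist (isEmbedding_loopVer m).continuous) continuous_const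
  obtain ⟨g, hg, p, hpm, hpd, -, hp⟩ := mem_closure_iff.1 hf _ hopen (by simp)
  let W : ℝ[X] := ∑ i, R i * p i
  have hdeg : ∀ i, (R i * p i).natDegree = k + n := fun i => by
    rw [(hR i).1.natDegree_mul (hpm i), (hR i).2, hpd]
  have hcoeff : W.coeff (k + n) = m + 1 := by
    have : ∀ i, (R i * p i).coeff (k + n) = 1 := fun i => by
      rw [← hdeg i]; exact (hR i).1.mul (hpm i)
    simp [W, finsetSum_coeff, this]
  have hW : W.natDegree = k + n := le_antisymm
    (natDegree_sum_le_of_forall_le _ _ fun i _ => (hdeg i).le)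
    (le_natDegree_of_ne_zero (by rw [hcoeff]; positivity))
  rw [← hW]
  refine even_natDegree_of_eval_ne_zero fun x h0 => ?_
  obtain ⟨hpx, hgx⟩ := hp x
  have hu : (WithLp.toLp 2 fun i => (R i).eval x : EuclideanSpace ℝ (Fin (m + 1))) ≠ 0 :=
    (WithLp.toLp_eq_zero 2).ne.2 (hx x).1
  have hw : (WithLp.toLp 2 fun i => (p i).eval x : EuclideanSpace ℝ (Fin (m + 1))) ≠ 0 :=
    (WithLp.toLp_eq_zero 2).ne.2 hpx
  have h1 : f.1 x = pt _ hu := (mem_line_pt hu _).1 (hx x).2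
  have h2 : g.1 x = pt _ hw := hgx
  have h3 := dist_veronese_sq hu hw
  have h4 := (ContinuousMap.dist_apply_le_dist (f := loopVer f) (g := loopVer g)
    (x : OnePoint ℝ)).trans_lt hg
  rw [loopVer_apply, loopVer_apply, h1, h2] at h4
  have h5 : cosSq (WithLp.toLp 2 fun i => (R i).eval x : EuclideanSpace ℝ (Fin (m + 1)))
      (WithLp.toLp 2 fun i => (p i).eval x) = 0 := by
    have : inner ℝ (WithLp.toLp 2 fun i => (R i).eval x : EuclideanSpace ℝ (Fin (m + 1)))
        (WithLp.toLp 2 fun i => (p i).eval x) = W.eval x := by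
      rw [PiLp.inner_apply]
      simp [W, eval_finsetSum, mul_comm]
    rw [cosSq, this, h0]; simp
  rw [h5] at h3
  have h6 := dist_nonneg (x := veronese (pt _ hu)) (y := veronese (pt _ hw))
  nlinarith

theorem polyP_coeff {S : Polynomial ℝ} (hS : S.Monic) (hd : S.natDegree = n) :
    polyP (fun j : Fin n => S.coeff j) = S := by
  conv_rhs => rw [hS.as_sum, hd, Finset.sum_range]
  rfl

open Polynomial in
theorem exists_ratLoop_eq {f : OmegaRP m} (hf : f ∈ ratSet n m) :
    ∃ a : realLocus n m, ratLoop a = f := by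
  obtain ⟨k, hk, R, hR, hx⟩ := exists_rootFree_of_mem_ratSet hf
  obtain ⟨d, hd⟩ : ∃ d, n = k + 2 * d := by
    have := even_add_of_mem_ratSet hf hR hx
    rw [Nat.even_add] at this
    obtain ⟨d, hd⟩ := (Nat.even_sub hk).2 this.symm
    exact ⟨d, by omega⟩
  have hX : (X ^ 2 + C 1 : ℝ[X]).Monic := monic_X_pow_add_C 1 two_ne_zero
  have hXd : (X ^ 2 + C 1 : ℝ[X]).natDegree = 2 := natDegree_X_pow_add_C
  let S : Fin (m + 1) → ℝ[X] := fun i => (X ^ 2 + C 1) ^ d * R i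
  have hS : ∀ i, (S i).Monic := fun i => (hX.pow d).mul (hR i).1
  have hSd : ∀ i, (S i).natDegree = n := fun i => by
    rw [(hX.pow d).natDegree_mul (hR i).1, hX.natDegree_pow, hXd, (hR i).2, hd]; ring
  let a : Fin (m + 1) → Fin n → ℝ := fun i j => (S i).coeff j
  have ha : ∀ x, (evV a x).ofLp = (x ^ 2 + 1) ^ d • fun i => (R i).eval x := fun x => by
    funext i
    rw [evV_apply, ← eval_polyP, polyP_coeff (hS i) (hSd i)]
    simp [S]
  have hmem : a ∈ realLocus n m := mem_realLocus_iff.2 fun x => by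
    rw [← (WithLp.ofLp_eq_zero 2).ne, ha]
    exact smul_ne_zero (by positivity) (hx x).1
  refine ⟨⟨a, hmem⟩, Subtype.ext (ContinuousMap.ext fun z => ?_)⟩
  induction z using OnePoint.rec with
  | infty => rw [(ratLoop _).2, f.2]
  | coe x =>
    rw [ratLoop_coe]
    refine ((mem_line_pt _ _).1 ?_).symm
    rw [ha]
    exact (f.1 x).submodule.smul_mem _ (hx x).2

end

section

variable {n m : ℕ}

open Filter Topology in
theorem exists_continuous_near {Y : Type*} [TopologicalSpace Y] [NormalSpace Y] [ParacompactSpace Y]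
    {F : Y → realLocus n m} (hF : Continuous fun y => ratLoop (F y)) {τ : Y → ℝ}
    (hτ : Continuous τ) (h0 : ∀ y, 0 ≤ τ y) (h1 : ∀ y, τ y < 1) {A : Set Y} (hA : IsClosed A)
    {a : realLocus n m} (hFA : ∀ y ∈ A, F y = a) :
    ∃ G : C(Y, realLocus n m), (∀ y ∈ A, G y = a) ∧ ∀ y, Near (τ y) (G y).1 (F y).1 := by
  have hL : Continuous fun y => loopVer (ratLoop (F y)) :=
    (isEmbedding_loopVer m).continuous.comp hF
  obtain ⟨g, hg⟩ := exists_continuous_forall_mem_convex_of_local_const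
    (t := fun y => {b | Near (τ y) b (F y).1} ∩ {b | y ∈ A → b = a.1})
    (fun y => (convex_near (h0 y) _).inter fun b hb c hc s t _ _ hst hy => by
      rw [hb hy, hc hy, ← add_smul, hst, one_smul])
    (fun x => ⟨(F x).1, by
      have hopen : IsOpen {y | dist (loopVer (ratLoop (F x))) (loopVer (ratLoop (F y))) ^ 2 <
          2 * (1 - τ y ^ 2)} :=
        isOpen_lt ((continuous_const.dist hL).pow 2) (by fun_prop)
      have hx : x ∈ {y | dist (loopVer (ratLoop (F x))) (loopVer (ratLoop (F y))) ^ 2 <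
          2 * (1 - τ y ^ 2)} := by
        have := h0 x
        have := h1 x
        simp only [Set.mem_ofPred_eq, dist_self]
        nlinarith
      have hA' : ∀ᶠ y in 𝓝 x, y ∈ A → (F x).1 = a.1 := by
        by_cases hxA : x ∈ A
        · exact .of_forall fun y _ => by rw [hFA x hxA]
        · filter_upwards [hA.isOpen_compl.mem_nhds hxA] with y hy hy'
          exact absurd hy' hy
      filter_upwards [hopen.mem_nhds hx, hA'] with y hy hy'
      exact ⟨near_of_dist_lt (h0 y) hy, hy'⟩⟩)
  exact ⟨⟨fun y => ⟨g y, (hg y).1.mem_realLocus⟩, by fun_prop⟩,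
    fun y hy => Subtype.ext ((hg y).2 hy), fun y => (hg y).1⟩

variable [NeZero n] [NeZero m]

/-- `ratLoop` as a map onto `ratSet n m`. -/
def ratProj : C(realLocus n m, ratSet n m) where
  toFun a := ⟨ratLoop a, ratLoop_mem_ratSet a⟩

theorem exists_ratProj_eq (f : ratSet n m) : ∃ a : realLocus n m, ratProj a = f := by
  obtain ⟨a, ha⟩ := exists_ratLoop_eq f.2
  exact ⟨a, Subtype.ext ha⟩

theorem exists_continuous_near_lift {Y : Type*} [TopologicalSpace Y] [NormalSpace Y]
    [ParacompactSpace Y] (f : C(Y, ratSet n m)) {A B : Set Y} {b : Y → realLocus n m}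
    {τ : Y → ℝ} (hτ : Continuous τ) (h0 : ∀ y, 0 ≤ τ y) (h1 : ∀ y, τ y < 1) (hA : IsClosed A)
    {a : realLocus n m} (hfA : ∀ y ∈ A, f y = ratProj a) (hfB : ∀ y ∈ B, f y = ratProj (b y))
    (hab : ∀ y ∈ A ∩ B, b y = a) :
    ∃ G : C(Y, realLocus n m), (∀ y ∈ A, G y = a) ∧ (∀ y ∈ B, Near (τ y) (G y).1 (b y).1) ∧
      ∀ y, dist (loopVer (ratProj (G y)).1) (loopVer (f y).1) ≤ √(2 * (1 - τ y ^ 2)) := by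
  classical
  choose F hF using fun y => exists_ratProj_eq (f y)
  let F' : Y → realLocus n m := fun y => if y ∈ A then a else if y ∈ B then b y else F y
  have hF' : ∀ y, ratProj (F' y) = f y := fun y => by
    simp only [F']
    split_ifs with h h'
    exacts [(hfA y h).symm, (hfB y h').symm, hF y]
  obtain ⟨G, hGA, hG⟩ := exists_continuous_near (F := F') (τ := τ) (A := A) (a := a)
    (by
      have : (fun y => ratLoop (F' y)) = fun y => (f y).1 := funext fun y => by rw [← hF']; rfl
      rw [this]; fun_prop) hτ h0 h1 hA (fun y hy => if_pos hy)
  refine ⟨G, hGA, fun y hy => ?_, fun y => ?_⟩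
  · have : F' y = b y := by
      simp only [F']
      split_ifs with h
      exacts [(hab y ⟨h, hy⟩).symm, rfl]
    exact this ▸ hG y
  · rw [← hF']
    exact dist_le_of_near (h0 y) (hG y)

open unitInterval Filter Topology in
theorem exists_homotopic_map_ratProj {a : realLocus n m} (p : Path (ratProj a) (ratProj a)) :
    ∃ q : Path a a, (q.map ratProj.continuous).Homotopic p := by
  obtain ⟨G, hGA, -, hG⟩ := exists_continuous_near_lift (Y := I × Set.Ico (0 : ℝ) 1)
    (⟨fun y => p y.1, by fun_prop⟩)
    (A := {y | y.1 = 0 ∨ y.1 = 1}) (B := ∅) (b := fun _ => a) (τ := fun y => y.2.1)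
    (by fun_prop) (fun y => y.2.2.1) (fun y => y.2.2.2)
    ((isClosed_eq continuous_fst continuous_const).union
      (isClosed_eq continuous_fst continuous_const))
    (a := a) (by rintro y (h | h) <;> simp [h]) (by simp) (by simp)
  let H : I × I → ratSet n m := fun z =>
    if h : z.1.1 < 1 then ratProj (G (z.2, ⟨z.1.1, z.1.2.1, h⟩)) else p z.2
  have hH1 : ∀ z : I × I, ¬ z.1.1 < 1 → H z = p z.2 := fun z h => dif_neg h
  have hemb : Topology.IsInducing fun f : ratSet n m => loopVer f.1 :=
    (isEmbedding_loopVer m).isInducing.comp .subtypeVal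
  have hd : ∀ z, dist (loopVer (H z).1) (loopVer (p z.2).1) ≤ √(2 * (1 - z.1.1 ^ 2)) := fun z => by
    by_cases h : z.1.1 < 1
    · simp only [H, dif_pos h]
      exact hG (z.2, ⟨z.1.1, z.1.2.1, h⟩)
    · rw [hH1 z h, dist_self]
      exact Real.sqrt_nonneg _
  have hp : Continuous fun z : I × I => loopVer (p z.2).1 :=
    hemb.continuous.comp (p.continuous.comp continuous_snd)
  have hH : Continuous H := by
    rw [hemb.continuous_iff, continuous_iff_continuousAt]
    intro z
    by_cases h : z.1.1 < 1
    · have ho : IsOpen {z : I × I | z.1.1 < 1} := isOpen_lt (by fun_prop) continuous_const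
      refine ContinuousOn.continuousAt (s := {z : I × I | z.1.1 < 1}) ?_ (ho.mem_nhds h)
      refine hemb.continuous.comp_continuousOn ?_
      rw [continuousOn_iff_continuous_domRestrict]
      have : Set.domRestrict {z : I × I | z.1.1 < 1} H =
          fun z => ratProj (G (z.1.2, ⟨z.1.1.1, z.1.1.2.1, z.2⟩)) := funext fun z => dif_pos z.2
      rw [this]
      fun_prop
    · have hz : z.1.1 = 1 := le_antisymm z.1.2.2 (not_lt.1 h)
      have hlim : Tendsto (fun w : I × I => √(2 * (1 - w.1.1 ^ 2)) +
          dist (loopVer (p w.2).1) (loopVer (p z.2).1)) (𝓝 z) (𝓝 0) := by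
        have hc : Continuous (fun w : I × I => √(2 * (1 - w.1.1 ^ 2)) +
            dist (loopVer (p w.2).1) (loopVer (p z.2).1)) :=
          (by fun_prop : Continuous fun w : I × I => √(2 * (1 - w.1.1 ^ 2))).add
            (hp.dist continuous_const)
        have := hc.tendsto z
        simpa [hz] using this
      refine tendsto_iff_dist_tendsto_zero.2 (squeeze_zero (fun _ => dist_nonneg)
        (fun w => ?_) hlim)
      simp only [Function.comp_apply, hH1 z h]
      exact (dist_triangle _ (loopVer (p w.2).1) _).trans (add_le_add_left (hd w) _)
  have hG' : ∀ (t : I) (s : Set.Ico (0 : ℝ) 1), t = 0 ∨ t = 1 → G (t, s) = a := fun t s h =>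
    hGA (t, s) h
  refine ⟨⟨⟨fun t => G (t, ⟨0, le_rfl, one_pos⟩), by fun_prop⟩, hG' _ _ (.inl rfl),
    hG' _ _ (.inr rfl)⟩, ⟨⟨⟨⟨H, hH⟩, fun t => ?_, fun t => ?_⟩, fun s t ht => ?_⟩⟩⟩
  · exact dif_pos one_pos
  · exact hH1 _ (lt_irrefl _)
  · have hpt : p t = ratProj a := by rcases ht with rfl | rfl <;> simp
    have hGt : ∀ s : Set.Ico (0 : ℝ) 1, G (t, s) = a := fun s => hG' t s ht
    change H (s, t) = ratProj (G (t, _))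
    rw [hGt]
    by_cases h : s.1 < 1
    · exact (dif_pos h).trans (by rw [hGt])
    · rw [hH1 _ h, hpt]

open unitInterval in
theorem homotopic_refl_of_map_ratProj {a : realLocus n m} {γ : Path a a}
    (h : (γ.map ratProj.continuous).Homotopic (Path.refl (ratProj a))) :
    γ.Homotopic (Path.refl a) := by
  obtain ⟨H⟩ := h
  obtain ⟨G, hGA, hGB, -⟩ := exists_continuous_near_lift (Y := I × I) H.toContinuousMap
    (A := {y | (y.2 = 0 ∨ y.2 = 1) ∨ y.1 = 1}) (B := {y | y.1 = 0}) (b := fun y => γ y.2)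
    (τ := fun _ => 0) continuous_const (fun _ => le_rfl) (fun _ => one_pos)
    (((isClosed_eq continuous_snd continuous_const).union
      (isClosed_eq continuous_snd continuous_const)).union
      (isClosed_eq continuous_fst continuous_const))
    (a := a) (by rintro ⟨s, t⟩ ((h | h) | h) <;> dsimp only at h <;> subst h <;> simp)
    (by rintro ⟨s, t⟩ h; change s = 0 at h; subst h; simp)
    (by rintro ⟨s, t⟩ ⟨((h | h) | h), h'⟩ <;> dsimp only at h h' <;> simp_all)
  have hG0 : ∀ s t : I, t = 0 ∨ t = 1 → G (s, t) = a := fun s t h => hGA (s, t) (.inl h)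
  let δ : Path a a := ⟨⟨fun t => G (0, t), by fun_prop⟩, hG0 _ _ (.inl rfl), hG0 _ _ (.inr rfl)⟩
  have h1 : δ.Homotopic (Path.refl a) :=
    ⟨⟨⟨G, fun t => rfl, fun t => hGA (1, t) (.inr rfl)⟩, fun s t ht => by
      change G (s, t) = G (0, t)
      rw [hG0 s t ht, hG0 0 t ht]⟩⟩
  have hmem : ∀ s t : I, (1 - s.1) • (G (0, t)).1 + s.1 • (γ t).1 ∈ realLocus n m := fun s t =>
    (convex_near le_rfl (γ t).1 (hGB (0, t) rfl) (near_refl one_pos (γ t)) (sub_nonneg.2 s.2.2)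
      s.2.1 (sub_add_cancel _ _)).mem_realLocus
  have h2 : δ.Homotopic γ := by
    refine ⟨⟨⟨⟨fun z => ⟨_, hmem z.1 z.2⟩, by fun_prop⟩, fun t => ?_, fun t => ?_⟩,
      fun s t ht => ?_⟩⟩
    · refine Subtype.ext ?_
      simp [δ]
    · refine Subtype.ext ?_
      simp
    · refine Subtype.ext ?_
      have hγ : γ t = a := by rcases ht with rfl | rfl <;> simp
      change (1 - s.1) • (G (0, t)).1 + s.1 • (γ t).1 = (G (0, t)).1
      rw [hG0 0 t ht, hγ, ← add_smul, sub_add_cancel, one_smul]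
  exact h2.symm.trans h1

theorem bijective_map_ratProj (a : realLocus n m) :
    Function.Bijective (FundamentalGroup.map (ratProj (n := n) (m := m)) a) := by
  constructor
  · refine (injective_iff_map_eq_one _).2 fun x hx => ?_
    obtain ⟨γ, rfl⟩ := Path.Homotopic.Quotient.mk_surjective x
    exact Path.Homotopic.Quotient.eq.2
      (homotopic_refl_of_map_ratProj (Path.Homotopic.Quotient.eq.1 hx))
  · intro x
    obtain ⟨p, rfl⟩ := Path.Homotopic.Quotient.mk_surjective x
    obtain ⟨q, hq⟩ := exists_homotopic_map_ratProj p
    exact ⟨Path.Homotopic.Quotient.mk q, Path.Homotopic.Quotient.eq.2 hq⟩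

end

section

theorem evQ_re_im {n : ℕ} (a : Fin 3 → Fin n → ℝ) (x : ℝ) :
    evQ x (fun i => (⟨a 1 i - a 0 i, a 2 i - a 0 i⟩ : ℂ)) =
      ⟨evP x (a 1) - evP x (a 0), evP x (a 2) - evP x (a 0)⟩ := by
  rw [evQ_apply]
  apply Complex.ext <;>
  · simp only [Complex.re_sum, Complex.im_sum, ← Complex.ofReal_pow, Complex.re_ofReal_mul,
      Complex.im_ofReal_mul, evP, add_sub_add_left_eq_sub, ← Finset.sum_sub_distrib]
    exact Finset.sum_congr rfl fun i _ => by ring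

/-- Triples of monic real polynomials without common real root correspond to coprime pairs. -/
def realLocusHomeomorph (n : ℕ) : realLocus n 2 ≃ₜ coprimeLocus n where
  toFun a := ⟨(a.1 0, fun i => ⟨a.1 1 i - a.1 0 i, a.1 2 i - a.1 0 i⟩), fun x h0 hq => by
    obtain ⟨i, hi⟩ := a.2 x
    refine hi ?_
    simp only [evQ_re_im, h0, sub_zero, Complex.ext_iff, Complex.zero_re, Complex.zero_im] at hq
    fin_cases i
    exacts [h0, hq.1, hq.2]⟩
  invFun e := ⟨![e.1.1, fun i => e.1.1 i + (e.1.2 i).re, fun i => e.1.1 i + (e.1.2 i).im],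
    fun x => by
      by_contra! h
      refine e.2 x (h 0) ?_
      have h1 := evQ_re_im ![e.1.1, fun i => e.1.1 i + (e.1.2 i).re,
        fun i => e.1.1 i + (e.1.2 i).im] x
      rw [h 0, h 1, h 2] at h1
      exact (by simpa using h1 : evQ x (fun i => e.1.2 i) = ⟨0, 0⟩)⟩
  left_inv a := by
    ext i j
    fin_cases i <;> simp
  right_inv e := by
    ext j <;> simp
  continuous_toFun := by
    have h (k i) : Continuous fun a : realLocus n 2 => a.1 k i :=
      (continuous_apply_apply k i).comp continuous_subtype_val
    have hc (i) : Continuous fun a : realLocus n 2 =>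
        Complex.equivRealProdCLM.symm (a.1 1 i - a.1 0 i, a.1 2 i - a.1 0 i) :=
      Complex.equivRealProdCLM.symm.continuous.comp
        (((h 1 i).sub (h 0 i)).prodMk ((h 2 i).sub (h 0 i)))
    exact ((((continuous_apply 0).comp continuous_subtype_val).prodMk
      (continuous_pi fun i => hc i))).subtype_mk _
  continuous_invFun := by
    refine Continuous.subtype_mk (continuous_pi fun k => ?_) _
    fin_cases k <;> simp <;> fun_prop

variable {X Y : Type*} [TopologicalSpace X] [TopologicalSpace Y]

/-- The isomorphism of fundamental groups induced by a homeomorphism. -/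
def Homeomorph.fundamentalGroupMulEquiv (e : X ≃ₜ Y) (x : X) :
    FundamentalGroup X x ≃* FundamentalGroup Y (e x) :=
  (FundamentalGroupoidFunctor.equivOfHomotopyEquiv
    e.toHomotopyEquiv).fullyFaithfulFunctor.mulEquivEnd (FundamentalGroupoid.mk x)

end

/-- For every `n ≥ 1`, the fundamental group of `rat(n,2)`, at any basepoint,
is isomorphic to `ℤ`. -/
theorem fundamentalGroup_ratSet_n2 (n : ℕ) (hn : 1 ≤ n) (x : ↥(ratSet n 2)) :
    Nonempty (FundamentalGroup ↥(ratSet n 2) x ≃* Multiplicative ℤ) := by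
  have : NeZero n := ⟨by omega⟩
  obtain ⟨a, rfl⟩ := exists_ratProj_eq x
  obtain ⟨e⟩ := nonempty_fundamentalGroup_coprimeLocus (realLocusHomeomorph n a)
  exact ⟨(MulEquiv.ofBijective _ (bijective_map_ratProj a)).symm.trans
    (((realLocusHomeomorph n).fundamentalGroupMulEquiv a).trans e)⟩

end
end

section
/- The space rat(1,2) is homotopy equivalent to the circle S¹. -/
open OnePoint Projectivization

noncomputable section

namespace RatOneTwo

/-- The difference coordinates `(v₁ - v₀) + i (v₂ - v₀)` of a vector of `ℝ³`; they vanish exactly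
on the line of the basepoint. -/
def transverse (v : Fin 3 → ℝ) : ℂ := ⟨v 1 - v 0, v 2 - v 0⟩

/-- The vector of `ℝ³` with zeroth coordinate `σ` and difference coordinates `w`. -/
def vec (σ : ℝ) (w : ℂ) : Fin 3 → ℝ := ![σ, σ + w.re, σ + w.im]

@[simp] lemma vec_zero (σ : ℝ) (w : ℂ) : vec σ w 0 = σ := rfl

@[simp] lemma transverse_vec (σ : ℝ) (w : ℂ) : transverse (vec σ w) = w := by
  apply Complex.ext <;> simp [transverse, vec]

lemma transverse_smul (t : ℝ) (v : Fin 3 → ℝ) : transverse (t • v) = t • transverse v := by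
  apply Complex.ext <;> simp [transverse, mul_sub]

@[fun_prop]
lemma continuous_transverse : Continuous transverse := by
  have : transverse = fun v => Complex.equivRealProdCLM.symm (v 1 - v 0, v 2 - v 0) := by
    ext v; apply Complex.ext <;> simp [transverse]
  rw [this]
  fun_prop

lemma continuous_vec : Continuous fun p : ℝ × ℂ => vec p.1 p.2 := by
  refine continuous_pi fun i => ?_
  fin_cases i <;> simp [vec] <;> fun_prop

lemma vec_ne_zero {σ : ℝ} {w : ℂ} (h : σ ≠ 0 ∨ w ≠ 0) : vec σ w ≠ 0 := by
  rintro h0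
  have hσ : σ = 0 := congrFun h0 0
  have hw : w = 0 := by
    rw [← transverse_vec σ w, h0]
    apply Complex.ext <;> simp [transverse]
  tauto

/-- A positive definite quadratic form on `ℝ³`. -/
def form (v : Fin 3 → ℝ) : ℝ := v 0 ^ 2 + Complex.normSq (transverse v)

lemma form_smul (t : ℝ) (v : Fin 3 → ℝ) : form (t • v) = t ^ 2 * form v := by
  simp [form, transverse_smul, Complex.normSq_apply]
  ring

lemma form_ne_zero {v : Fin 3 → ℝ} (hv : v ≠ 0) : form v ≠ 0 := by
  intro h
  have h1 := sq_nonneg (v 0)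
  have h2 := Complex.normSq_nonneg (transverse v)
  have h3 : v 0 = 0 := by
    have : v 0 ^ 2 = 0 := by unfold form at h; linarith
    simpa using this
  have h4 : transverse v = 0 := by
    apply Complex.normSq_eq_zero.1
    unfold form at h; linarith
  have h5 := congrArg Complex.re h4
  have h6 := congrArg Complex.im h4
  simp only [transverse, h3, sub_zero, Complex.zero_re, Complex.zero_im] at h5 h6
  apply hv
  ext i
  fin_cases i <;> assumption

lemma continuous_form : Continuous form := by
  unfold form
  fun_prop

section ratio

variable {E : Type*} [AddCommGroup E] [Module ℝ E] (Q : (Fin 3 → ℝ) → E)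
  (hQ : ∀ (t : ℝ) v, Q (t • v) = t ^ 2 • Q v)

/-- The function on `ℝP²` induced by a function on `ℝ³` that is homogeneous of degree two. -/
def ratio : RP 2 → E :=
  Projectivization.lift (fun v => (form v.1)⁻¹ • Q v.1) (by
    rintro ⟨a, ha⟩ ⟨b, hb⟩ t (rfl : a = t • b)
    have ht : t ≠ 0 := by rintro rfl; simp at ha
    have hb' := form_ne_zero hb
    change (form (t • b))⁻¹ • Q (t • b) = (form b)⁻¹ • Q b
    rw [hQ, form_smul, smul_smul]
    congr 1
    field_simp)

@[simp] lemma ratio_mk (v : Fin 3 → ℝ) (hv : v ≠ 0) :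
    ratio Q hQ (Projectivization.mk ℝ v hv) = (form v)⁻¹ • Q v := rfl

lemma continuous_ratio [TopologicalSpace E] [ContinuousSMul ℝ E] (hc : Continuous Q) :
    Continuous (ratio Q hQ) := by
  refine continuous_quot_lift _ ?_
  refine Continuous.smul (Continuous.inv₀ ?_ fun v => form_ne_zero v.2) ?_
  · exact continuous_form.comp continuous_subtype_val
  · exact hc.comp continuous_subtype_val

end ratio

lemma continuous_mk {X : Type*} [TopologicalSpace X] {f : X → Fin 3 → ℝ} (hf : Continuous f)
    (h0 : ∀ x, f x ≠ 0) : Continuous fun x => (Projectivization.mk ℝ (f x) (h0 x) : RP 2) :=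
  continuous_quot_mk.comp (hf.subtype_mk h0)

instance : T2Space (RP 2) := by
  have hQ (t : ℝ) (v : Fin 3 → ℝ) : (fun i j => (t • v) i * (t • v) j : Fin 3 → Fin 3 → ℝ) =
      t ^ 2 • fun i j => v i * v j := by
    ext i j; simp; ring
  refine T2Space.of_injective_continuous (f := ratio (fun v i j => v i * v j) hQ) ?_
    (continuous_ratio _ hQ (by fun_prop))
  intro p q h
  induction p using Projectivization.ind with | h v hv => ?_
  induction q using Projectivization.ind with | h u hu => ?_
  rw [ratio_mk, ratio_mk] at h
  obtain ⟨j, hj⟩ := Function.ne_iff.1 hu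
  rw [Projectivization.mk_eq_mk_iff']
  have hfu := form_ne_zero hu
  have hfv := form_ne_zero hv
  have hij (i k : Fin 3) : form u * (v i * v k) = form v * (u i * u k) := by
    have := congrFun (congrFun h i) k
    simp only [Pi.smul_apply, smul_eq_mul] at this
    field_simp at this
    linarith
  have hvj : v j ≠ 0 := by
    intro h0
    have := hij j j
    simp_all
  refine ⟨form v * u j / (form u * v j), ?_⟩
  ext i
  have := hij i j
  simp only [Pi.smul_apply, smul_eq_mul]
  field_simp
  linarith

/-- The part of a point of `ℝP²` along the zeroth coordinate; it vanishes where that does. -/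
def along : RP 2 → ℝ := ratio (fun v => v 0 ^ 2) (by intros; simp; ring)

/-- A function on `ℝP²` vanishing exactly at the basepoint. -/
def away : RP 2 → ℝ := ratio (fun v => Complex.normSq (transverse v))
  (by intros; simp [transverse_smul, Complex.normSq_apply]; ring)

/-- The mixed quadratic term `v₀ (v₁ - v₀, v₂ - v₀)` on `ℝP²`. -/
def mixed : RP 2 → ℂ := ratio (fun v => v 0 • transverse v)
  (by intros; simp [transverse_smul]; ring)

/-- The map `[σ : w] ↦ σ / w̄` on the complement of the basepoint of `ℝP²`. -/
def slope (y : RP 2) : ℂ := mixed y / away y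

lemma continuous_along : Continuous along := continuous_ratio _ _ (by fun_prop)

lemma continuous_away : Continuous away := continuous_ratio _ _ (by fun_prop)

lemma continuous_mixed : Continuous mixed := continuous_ratio _ _ (by fun_prop)

lemma continuousAt_slope {y : RP 2} (hy : away y ≠ 0) : ContinuousAt slope y :=
  continuous_mixed.continuousAt.div
    (Complex.continuous_ofReal.comp continuous_away).continuousAt (by simpa using hy)

lemma along_add_away (y : RP 2) : along y + away y = 1 := by
  induction y using Projectivization.ind with | h v hv => ?_
  have := form_ne_zero hv
  simp only [along, away, ratio_mk, smul_eq_mul]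
  rw [← mul_add]
  exact inv_mul_cancel₀ this

lemma normSq_mixed (y : RP 2) : Complex.normSq (mixed y) = along y * away y := by
  induction y using Projectivization.ind with | h v hv => ?_
  simp only [along, away, mixed, ratio_mk, smul_eq_mul, Complex.real_smul, Complex.normSq_mul,
    Complex.normSq_ofReal]
  ring

lemma slope_eq_zero_iff {y : RP 2} (hy : away y ≠ 0) : slope y = 0 ↔ along y = 0 := by
  rw [slope, div_eq_zero_iff, or_iff_left (by simpa using hy), ← Complex.normSq_eq_zero,
    normSq_mixed, mul_eq_zero, or_iff_left hy]

lemma along_basept : along (basept 2) = 1 := by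
  simp [along, basept, form, transverse, Complex.normSq_apply]

lemma away_mk_vec {σ : ℝ} {w : ℂ} (hw : w ≠ 0) :
    away (Projectivization.mk ℝ (vec σ w) (vec_ne_zero (.inr hw))) ≠ 0 := by
  simp [away, hw, form_ne_zero (vec_ne_zero (.inr hw : σ ≠ 0 ∨ w ≠ 0))]

lemma slope_mk_vec {σ : ℝ} {w : ℂ} (hw : w ≠ 0) :
    slope (Projectivization.mk ℝ (vec σ w) (vec_ne_zero (.inr hw))) =
      σ / (starRingEnd ℂ) w := by
  have h := form_ne_zero (vec_ne_zero (.inr hw : σ ≠ 0 ∨ w ≠ 0))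
  have hw' : (starRingEnd ℂ) w ≠ 0 := by simpa using hw
  have h' : (form (vec σ w) : ℂ) ≠ 0 := by exact_mod_cast h
  simp only [slope, mixed, away, ratio_mk, transverse_vec, vec_zero, smul_eq_mul,
    Complex.real_smul, Complex.ofReal_mul, Complex.ofReal_inv, ← Complex.mul_conj]
  field_simp

/-- The parameter space of degree one loops: `(s, w)` stands for `x ↦ [x - s : w]` in the
coordinates of `vec`. -/
abbrev Param := ℝ × {w : ℂ // w ≠ 0}

instance : Nonempty Param := ⟨0, 1, one_ne_zero⟩

/-- The degree one loop at a finite point. -/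
def affineLoop (p : Param × ℝ) : RP 2 :=
  Projectivization.mk ℝ (vec (p.2 - p.1.1) p.1.2) (vec_ne_zero (.inr p.1.2.2))

/-- The degree one loop in the coordinate `u = x⁻¹` near infinity. -/
def loopNearInfty (p : Param × ℝ) : RP 2 :=
  Projectivization.mk ℝ (vec (1 - p.1.1 * p.2) (p.2 • p.1.2.1)) (vec_ne_zero (by
    by_cases h : p.2 = 0
    · simp [h]
    · exact .inr (smul_ne_zero h p.1.2.2)))

lemma continuous_affineLoop : Continuous affineLoop :=
  continuous_mk (continuous_vec.comp (f := fun p : Param × ℝ => (p.2 - p.1.1, p.1.2.1))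
    (by fun_prop)) _

lemma continuous_loopNearInfty : Continuous loopNearInfty :=
  continuous_mk (continuous_vec.comp
    (f := fun p : Param × ℝ => (1 - p.1.1 * p.2, p.2 • p.1.2.1)) (by fun_prop)) _

lemma loopNearInfty_inv (b : Param) {x : ℝ} (hx : x ≠ 0) :
    loopNearInfty (b, x⁻¹) = affineLoop (b, x) := by
  rw [loopNearInfty, affineLoop, Projectivization.mk_eq_mk_iff']
  refine ⟨x⁻¹, ?_⟩
  ext i
  fin_cases i <;> simp [vec] <;> field_simp

lemma loopNearInfty_zero (b : Param) : loopNearInfty (b, 0) = basept 2 := by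
  rw [loopNearInfty, basept, Projectivization.mk_eq_mk_iff']
  refine ⟨1, ?_⟩
  ext i
  fin_cases i <;> simp [vec]

/-- The degree one loops, jointly in the parameter and the point of `ℝ ∪ {∞}`. -/
def loopFun (p : Param × OnePoint ℝ) : RP 2 :=
  p.2.elim (basept 2) fun x => affineLoop (p.1, x)

/-- The coordinate `x⁻¹` near infinity. -/
def invCoord (x : OnePoint ℝ) : ℝ := x.elim 0 fun x => x⁻¹

lemma continuousAt_invCoord : ContinuousAt invCoord ∞ := by
  rw [OnePoint.continuousAt_infty']
  have : Filter.coclosedCompact ℝ = Bornology.cobounded ℝ := by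
    rw [Filter.coclosedCompact_eq_cocompact, Metric.cobounded_eq_cocompact]
  rw [this]
  exact Filter.tendsto_inv₀_cobounded

lemma continuous_loopFun : Continuous loopFun := by
  rw [continuous_iff_continuousAt]
  rintro ⟨b, x⟩
  induction x using OnePoint.rec with
  | infty =>
    have h : ContinuousAt (fun p : Param × OnePoint ℝ => loopNearInfty (p.1, invCoord p.2))
        (b, ∞) :=
      continuous_loopNearInfty.continuousAt.comp
        (continuousAt_fst.prodMk (continuousAt_invCoord.comp_of_eq continuousAt_snd rfl))
    refine h.congr ?_
    have hne : ∀ᶠ p : Param × OnePoint ℝ in nhds (b, ∞), p.2 ≠ ((0 : ℝ) : OnePoint ℝ) :=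
      continuousAt_snd.eventually_ne (OnePoint.infty_ne_coe _)
    filter_upwards [hne]
    rintro ⟨b', x⟩ hx
    induction x using OnePoint.rec with
    | infty => exact loopNearInfty_zero b'
    | coe x => exact loopNearInfty_inv b' fun h => hx (by simp [h])
  | coe x =>
    have he : Topology.IsOpenEmbedding (Prod.map id ((↑) : ℝ → OnePoint ℝ) : Param × ℝ → _) :=
      Topology.IsOpenEmbedding.id.prodMap OnePoint.isOpenEmbedding_coe
    exact (he.continuousAt_iff (x := (b, x)) (g := loopFun)).1
      continuous_affineLoop.continuousAt

/-- The degree one loop with given parameter. -/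
def loop (b : Param) : OmegaRP 2 :=
  ⟨ContinuousMap.curry ⟨loopFun, continuous_loopFun⟩ b, rfl⟩

lemma loop_coe (b : Param) (x : ℝ) : (loop b).1 x = affineLoop (b, x) := rfl

lemma continuous_loop : Continuous loop :=
  (ContinuousMap.continuous _).subtype_mk _

lemma eq_loop {f : OmegaRP 2} {b : Param} (h : ∀ x : ℝ, f.1 x = affineLoop (b, x)) :
    f = loop b := by
  apply Subtype.ext
  ext x
  induction x using OnePoint.rec with
  | infty => exact f.2
  | coe x => exact h x

lemma RRat_one_two_eq_range : RRat 1 2 = Set.range loop := by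
  ext f
  constructor
  · rintro ⟨p, hm, hd, hroot, hf⟩
    have hp (i : Fin 3) : p i = Polynomial.X + Polynomial.C ((p i).coeff 0) := by
      have h1 := (p i).eq_X_add_C_of_natDegree_le_one (hd i).le
      have h2 : (p i).coeff 1 = 1 := by
        simpa only [Polynomial.Monic, Polynomial.leadingCoeff, hd i] using hm i
      rwa [h2, Polynomial.C_1, one_mul] at h1
    set a : Fin 3 → ℝ := fun i => (p i).coeff 0 with ha
    have hw : transverse a ≠ 0 := by
      intro h0
      obtain ⟨i, hi⟩ := hroot (-(a 0 : ℂ))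
      have h5 := congrArg Complex.re h0
      have h6 := congrArg Complex.im h0
      simp only [transverse, Complex.zero_re, Complex.zero_im, sub_eq_zero] at h5 h6
      apply hi
      rw [hp i]
      have : a i = a 0 := by fin_cases i <;> simp [h5, h6]
      simp only [map_add, Polynomial.aeval_X, Polynomial.aeval_C, Complex.coe_algebraMap]
      change -(a 0 : ℂ) + (a i : ℂ) = 0
      rw [this]; simp
    refine ⟨(-a 0, ⟨transverse a, hw⟩), (eq_loop fun x => ?_).symm⟩
    obtain ⟨hx, h⟩ := hf x
    rw [h, affineLoop]
    congr 1
    ext i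
    rw [hp i]
    simp only [Polynomial.eval_add, Polynomial.eval_X, Polynomial.eval_C]
    change x + a i = _
    fin_cases i <;> simp [vec, transverse]
  · rintro ⟨⟨s, w, hw⟩, rfl⟩
    refine ⟨fun i => Polynomial.X - Polynomial.C (s - vec 0 w i),
      fun i => Polynomial.monic_X_sub_C _, fun i => Polynomial.natDegree_X_sub_C _, ?_, ?_⟩
    · intro z
      by_contra! h
      have hv (i : Fin 3) : z = ((s - vec 0 w i : ℝ) : ℂ) := by
        have := h i
        rwa [map_sub, Polynomial.aeval_X, Polynomial.aeval_C, sub_eq_zero] at this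
      have h1 := (hv 0).symm.trans (hv 1)
      have h2 := (hv 0).symm.trans (hv 2)
      norm_cast at h1 h2
      apply hw
      apply Complex.ext
      · have : w.re = 0 := by simp [vec] at h1; linarith
        simpa using this
      · have : w.im = 0 := by simp [vec] at h2; linarith
        simpa using this
    · intro x
      have hv : (fun i => (Polynomial.X - Polynomial.C (s - vec 0 w i)).eval x) =
          vec (x - s) w := by
        ext i
        fin_cases i <;> simp [vec] <;> ring
      exact ⟨hv ▸ vec_ne_zero (.inr hw), by simp only [hv]; rfl⟩

lemma away_affineLoop (p : Param × ℝ) : away (affineLoop p) ≠ 0 := away_mk_vec p.1.2.2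

lemma slope_affineLoop (p : Param × ℝ) :
    slope (affineLoop p) = (p.2 - p.1.1) / (starRingEnd ℂ) p.1.2 := by
  rw [affineLoop, slope_mk_vec p.1.2.2]
  simp

/-- The difference of the slopes of a loop at two points. -/
def slopeDiff (x y : ℝ) (f : OmegaRP 2) : ℂ := slope (f.1 y) - slope (f.1 x)

/-- Recovers the transverse parameter of a degree one loop from its values at two points. -/
def readWeight (x y : ℝ) (f : OmegaRP 2) : ℂ := (starRingEnd ℂ) ((y - x) / slopeDiff x y f)

/-- Recovers the root of a degree one loop from its values at two points. -/
def readRoot (x y : ℝ) (f : OmegaRP 2) : ℝ :=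
  x - ((starRingEnd ℂ) (readWeight x y f) * slope (f.1 x)).re

lemma slopeDiff_loop (b : Param) (x y : ℝ) :
    slopeDiff x y (loop b) = (y - x) / (starRingEnd ℂ) b.2 := by
  simp only [slopeDiff, loop_coe, slope_affineLoop]
  ring

lemma readWeight_loop (b : Param) {x y : ℝ} (h : x ≠ y) : readWeight x y (loop b) = b.2 := by
  have h' : (y - x : ℂ) ≠ 0 := sub_ne_zero.2 (by exact_mod_cast h.symm)
  rw [readWeight, slopeDiff_loop, div_div_cancel₀ h', Complex.conj_conj]

lemma readRoot_loop (b : Param) {x y : ℝ} (h : x ≠ y) : readRoot x y (loop b) = b.1 := by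
  have hb : (starRingEnd ℂ) b.2.1 ≠ 0 := by simpa using b.2.2
  rw [readRoot, readWeight_loop b h, loop_coe, slope_affineLoop, mul_div_cancel₀ _ hb]
  simp

section continuity

variable {x y : ℝ} {f : OmegaRP 2}

lemma continuousAt_slope_eval (hx : away (f.1 x) ≠ 0) :
    ContinuousAt (fun g : OmegaRP 2 => slope (g.1 x)) f :=
  (continuousAt_slope hx).comp_of_eq
    ((continuous_eval_const _).comp continuous_subtype_val).continuousAt rfl

lemma continuousAt_readWeight (hx : away (f.1 x) ≠ 0) (hy : away (f.1 y) ≠ 0)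
    (h : slopeDiff x y f ≠ 0) : ContinuousAt (readWeight x y) f :=
  Complex.continuous_conj.continuousAt.comp
    (continuousAt_const.div ((continuousAt_slope_eval hy).sub (continuousAt_slope_eval hx)) h)

lemma continuousAt_readRoot (hx : away (f.1 x) ≠ 0) (hy : away (f.1 y) ≠ 0)
    (h : slopeDiff x y f ≠ 0) : ContinuousAt (readRoot x y) f :=
  continuousAt_const.sub (Complex.continuous_re.continuousAt.comp
    ((Complex.continuous_conj.continuousAt.comp (continuousAt_readWeight hx hy h)).mul
      (continuousAt_slope_eval hx)))

end continuity

lemma exists_along_eq_zero {f : OmegaRP 2} (hf : f ∈ closure (RRat 1 2)) :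
    ∃ x : OnePoint ℝ, along (f.1 x) = 0 := by
  by_contra! h
  have ho : IsOpen {g : OmegaRP 2 | Set.MapsTo g.1 Set.univ {y | along y ≠ 0}} :=
    (ContinuousMap.isOpen_setOfPred_mapsTo isCompact_univ
      (isOpen_ne_fun continuous_along continuous_const)).preimage continuous_subtype_val
  obtain ⟨g, hg, hg'⟩ := mem_closure_iff.1 hf _ ho fun x _ => h x
  rw [RRat_one_two_eq_range] at hg'
  obtain ⟨b, rfl⟩ := hg'
  refine hg (Set.mem_univ (b.1 : OnePoint ℝ)) ?_
  rw [loop_coe, ← slope_eq_zero_iff (away_affineLoop _), slope_affineLoop]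
  simp

lemma ratSet_one_two_eq_range : ratSet 1 2 = Set.range loop := by
  refine subset_antisymm (fun f hf => ?_) (RRat_one_two_eq_range ▸ subset_closure)
  obtain ⟨x, hx⟩ := exists_along_eq_zero hf
  have hinf : along (f.1 ∞) = 1 := by rw [f.2, along_basept]
  obtain ⟨y, hy⟩ : ∃ y, along (f.1 y) = 1 / 2 :=
    mem_range_of_exists_le_of_exists_ge (continuous_along.comp f.1.continuous)
      ⟨x, by simp [hx]⟩ ⟨∞, by simp only [hinf]; norm_num⟩
  obtain ⟨x, rfl⟩ := OnePoint.ne_infty_iff_exists.1 (show x ≠ ∞ by rintro rfl; simp_all)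
  obtain ⟨y, rfl⟩ := OnePoint.ne_infty_iff_exists.1
    (show y ≠ ∞ by rintro rfl; norm_num [hinf] at hy)
  have hxy : x ≠ y := by rintro rfl; norm_num [hx] at hy
  have hax : away (f.1 x) ≠ 0 := by have := along_add_away (f.1 x); intro h; simp [hx, h] at this
  have hay : away (f.1 y) ≠ 0 := by
    have := along_add_away (f.1 y); intro h; norm_num [hy, h] at this
  have hd : slopeDiff x y f ≠ 0 := by
    rw [slopeDiff, (slope_eq_zero_iff hax).2 hx, sub_zero, Ne, slope_eq_zero_iff hay, hy]
    norm_num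
  have hw : readWeight x y f ≠ 0 := by
    have h' : (y - x : ℂ) ≠ 0 := sub_ne_zero.2 (by exact_mod_cast hxy.symm)
    simpa [readWeight] using ⟨h', hd⟩
  have hcl : (nhdsWithin f (RRat 1 2)).NeBot := mem_closure_iff_nhdsWithin_neBot.1 hf
  have hinv : ∀ᶠ g in nhdsWithin f (RRat 1 2), loop (Function.invFun loop g) = g := by
    filter_upwards [self_mem_nhdsWithin] with g hg
    exact Function.invFun_eq (RRat_one_two_eq_range.subset hg)
  have hlim : Filter.Tendsto (Function.invFun loop) (nhdsWithin f (RRat 1 2))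
      (nhds (readRoot x y f, ⟨readWeight x y f, hw⟩)) := by
    refine Filter.Tendsto.prodMk_nhds ?_ (tendsto_subtype_rng.2 ?_)
    · refine ((continuousAt_readRoot hax hay hd).mono_left nhdsWithin_le_nhds).congr' ?_
      filter_upwards [hinv] with g hg
      exact (congrArg _ hg).symm.trans (readRoot_loop (Function.invFun loop g) hxy)
    · refine ((continuousAt_readWeight hax hay hd).mono_left nhdsWithin_le_nhds).congr' ?_
      filter_upwards [hinv] with g hg
      exact (congrArg _ hg).symm.trans (readWeight_loop (Function.invFun loop g) hxy)
  exact ⟨_, tendsto_nhds_unique ((continuous_loop.tendsto _).comp hlim)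
    ((Filter.tendsto_id'.2 nhdsWithin_le_nhds).congr' (hinv.mono fun g hg => hg.symm))⟩

/-- The degree one loops are parametrized homeomorphically. -/
def loopHomeomorph : Param ≃ₜ ratSet 1 2 where
  toFun b := ⟨loop b, ratSet_one_two_eq_range ▸ Set.mem_range_self b⟩
  invFun f := (readRoot 0 1 f, ⟨readWeight 0 1 f, by
    obtain ⟨b, hb⟩ := ratSet_one_two_eq_range.subset f.2
    rw [← hb, readWeight_loop b zero_ne_one]
    exact b.2.2⟩)
  left_inv b := Prod.ext (readRoot_loop b zero_ne_one)
    (Subtype.ext (readWeight_loop b zero_ne_one))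
  right_inv f := by
    obtain ⟨b, hb⟩ := ratSet_one_two_eq_range.subset f.2
    apply Subtype.ext
    simp only [← hb, readRoot_loop b zero_ne_one, readWeight_loop b zero_ne_one]
  continuous_toFun := continuous_loop.subtype_mk _
  continuous_invFun := by
    have key (f : ratSet 1 2) : away (f.1.1 (0 : ℝ)) ≠ 0 ∧ away (f.1.1 (1 : ℝ)) ≠ 0 ∧
        slopeDiff 0 1 f.1 ≠ 0 := by
      obtain ⟨b, hb⟩ := ratSet_one_two_eq_range.subset f.2
      rw [← hb, slopeDiff_loop]
      exact ⟨away_affineLoop _, away_affineLoop _, by simpa using b.2.2⟩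
    refine Continuous.prodMk ?_ (Continuous.subtype_mk ?_ _)
    · exact continuous_iff_continuousAt.2 fun f =>
        (continuousAt_readRoot (key f).1 (key f).2.1 (key f).2.2).comp
          continuous_subtype_val.continuousAt
    · exact continuous_iff_continuousAt.2 fun f =>
        (continuousAt_readWeight (key f).1 (key f).2.1 (key f).2.2).comp
          continuous_subtype_val.continuousAt

lemma radial_pos (t : unitInterval) {w : ℂ} (hw : w ≠ 0) : 0 < (1 - t.1) * ‖w‖⁻¹ + t.1 := by
  have h1 : 0 < ‖w‖⁻¹ := by positivity
  rcases t.2.1.eq_or_lt with h | h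
  · rw [← h]; simpa using h1
  · have := mul_nonneg (sub_nonneg.2 t.2.2) h1.le
    linarith

/-- The parameter space of degree one loops retracts onto the circle. -/
def paramHomotopyEquivCircle :
    ContinuousMap.HomotopyEquiv Param (Metric.sphere (0 : ℂ) 1) where
  toFun :=
    { toFun := fun b => ⟨‖b.2.1‖⁻¹ • b.2.1, by
        have := norm_ne_zero_iff.2 b.2.2
        simp [this]⟩
      continuous_toFun := by
        refine Continuous.subtype_mk ?_ _
        exact ((continuous_norm.comp (by fun_prop)).inv₀ fun b => norm_ne_zero_iff.2 b.2.2).smul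
          (by fun_prop) }
  invFun :=
    { toFun := fun z => (0, ⟨z.1, ne_zero_of_mem_unit_sphere z⟩)
      continuous_toFun := by fun_prop }
  left_inv := ⟨
    { toFun := fun p => (p.1.1 * p.2.1,
        ⟨((1 - p.1.1) * ‖p.2.2.1‖⁻¹ + p.1.1) • p.2.2.1,
          smul_ne_zero (radial_pos p.1 p.2.2.2).ne' p.2.2.2⟩)
      continuous_toFun := by
        refine Continuous.prodMk (by fun_prop) (Continuous.subtype_mk ?_ _)
        have : Continuous fun p : unitInterval × Param => ‖p.2.2.1‖⁻¹ :=
          Continuous.inv₀ (by fun_prop) fun p => norm_ne_zero_iff.2 p.2.2.2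
        fun_prop
      map_zero_left := fun b => by
        refine Prod.ext ?_ (Subtype.ext ?_) <;> simp
      map_one_left := fun b => by
        refine Prod.ext ?_ (Subtype.ext ?_) <;> simp }⟩
  right_inv := by
    convert ContinuousMap.Homotopic.refl _
    ext z
    have : ‖z.1‖ = 1 := norm_eq_of_mem_sphere z
    simp [this]

end RatOneTwo

/-- The space `rat(1,2)` is homotopy equivalent to the circle `S¹`. -/
theorem ratSet_one_two_homotopyEquiv_circle :
    Nonempty (ContinuousMap.HomotopyEquiv ↥(ratSet 1 2) ↥(Metric.sphere (0 : ℂ) 1)) := by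
  exact ⟨RatOneTwo.loopHomeomorph.symm.toHomotopyEquiv.trans RatOneTwo.paramHomotopyEquivCircle⟩

end
end
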